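/- arXiv:1702.06536 — 3 statements merged into one kernel-verified Lean document; each statement's English description precedes it below -/
import Mathlib

section
/- Schur-type integral estimates for the shifted kernel: let n ≥ 1, γ ∈ (0,1], and let k : ℝ^n × ℝ^n → ℂ be a measurable kernel satisfying the smoothness estimates with Lipschitz parameter γ. Then there is a constant c depending only on n and γ such that for every j ∈ ℤ and every integer s ≥ 0: (i) for every x ∈ ℝ^n, ∫_{ℝ^n} 1_{x ∉ 5Q_{y,j}} |k(x,y) − k(x, c_{y,j+s−1})| dy ≤ c · 2^{−sγ}; and (ii) for every y ∈ ℝ^n, ∫_{ℝ^n} 1_{x ∉ 5Q_{y,j}} |k(x,y) − k(x, c_{y,j+s−1})| dx ≤ c · 2^{−sγ}. -/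
open MeasureTheory Set
open scoped ENNReal

noncomputable section

/-- The dyadic cube of generation `m` containing `y`. -/
def dyadicCube (n : ℕ) (m : ℤ) (y : Fin n → ℝ) : Set (Fin n → ℝ) :=
  {z | ∀ i, ⌊(2:ℝ) ^ m * y i⌋ = ⌊(2:ℝ) ^ m * z i⌋}

/-- The center of the dyadic cube of generation `m` containing `y`. -/
def cubeCenter (n : ℕ) (m : ℤ) (y : Fin n → ℝ) : Fin n → ℝ :=
  fun i => (2:ℝ) ^ (-m) * (⌊(2:ℝ) ^ m * y i⌋ + 1/2)

/-- The `d`-fold dilation of the dyadic cube of generation `m` containing `y`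
(for the sup norm, which is the norm on `Fin n → ℝ`). -/
def dilatedCube (n : ℕ) (d : ℕ) (m : ℤ) (y : Fin n → ℝ) : Set (Fin n → ℝ) :=
  {z | ‖z - cubeCenter n m y‖ < d * (2:ℝ) ^ (-m) / 2}

/-- The dyadic cube of generation `m` with lower-left corner `2^{-m} a`. -/
def dyadicCubeOf (n : ℕ) (m : ℤ) (a : Fin n → ℤ) : Set (Fin n → ℝ) :=
  {z | ∀ i, (2:ℝ) ^ (-m) * a i ≤ z i ∧ z i < (2:ℝ) ^ (-m) * (a i + 1)}

/-- Center of the dyadic cube of generation `m` with lower-left corner `2^{-m} a`. -/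
def cubeCenterOf (n : ℕ) (m : ℤ) (a : Fin n → ℤ) : Fin n → ℝ :=
  fun i => (2:ℝ) ^ (-m) * (a i + 1/2)

/-- `d`-fold dilation of the dyadic cube of generation `m` with corner `2^{-m} a`. -/
def dilatedCubeOf (n : ℕ) (d : ℕ) (m : ℤ) (a : Fin n → ℤ) : Set (Fin n → ℝ) :=
  {z | ‖z - cubeCenterOf n m a‖ < d * (2:ℝ) ^ (-m) / 2}

/-- Dyadic conditional expectation `E_m f (x) = 2^{mn} ∫_{Q_{x,m}} f`. -/
def dyadicAvg (n : ℕ) (m : ℤ) (f : (Fin n → ℝ) → ℂ) (x : Fin n → ℝ) : ℂ :=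
  (2:ℝ) ^ (m * (n:ℤ)) • ∫ t in dyadicCube n m x, f t

/-- Martingale difference `Δ_m f = E_m f - E_{m-1} f`. -/
def dyadicDiff (n : ℕ) (m : ℤ) (f : (Fin n → ℝ) → ℂ) : (Fin n → ℝ) → ℂ :=
  fun x => dyadicAvg n m f x - dyadicAvg n (m - 1) f x

/-- Smoothness estimates with Lipschitz parameter `γ`, for the sup norm on `ℝ^n`. -/
def SmoothKernel (n : ℕ) (γ : ℝ) (k : (Fin n → ℝ) → (Fin n → ℝ) → ℂ) : Prop :=
  ∀ x y z : Fin n → ℝ, ‖x - z‖ ≤ (1/2) * ‖y - z‖ →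
    ‖k x y - k z y‖ ≤ ‖x - z‖ ^ γ / ‖y - z‖ ^ ((n:ℝ) + γ) ∧
    ‖k y x - k y z‖ ≤ ‖x - z‖ ^ γ / ‖y - z‖ ^ ((n:ℝ) + γ)

/-- Size condition `‖k(x,y)‖ ≤ |x-y|^{-n}`. -/
def SizeKernel (n : ℕ) (k : (Fin n → ℝ) → (Fin n → ℝ) → ℂ) : Prop :=
  ∀ x y : Fin n → ℝ, x ≠ y → ‖k x y‖ ≤ ‖x - y‖ ^ (-(n:ℝ))

/-- A point lies within half the side length of the center of its dyadic cube. -/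
theorem norm_sub_cubeCenter_le (n : ℕ) (m : ℤ) (y : Fin n → ℝ) :
    ‖y - cubeCenter n m y‖ ≤ (2:ℝ) ^ (-m) / 2 := by
  have h2 : (0:ℝ) < 2 ^ (-m) := by positivity
  refine (pi_norm_le_iff_of_nonneg (by positivity)).2 fun i => ?_
  have hy : y i = (2:ℝ) ^ (-m) * ((2:ℝ) ^ m * y i) := by
    rw [← mul_assoc, ← zpow_add₀ two_ne_zero, neg_add_cancel, zpow_zero, one_mul]
  have hlo := Int.floor_le ((2:ℝ) ^ m * y i)
  have hhi := Int.lt_floor_add_one ((2:ℝ) ^ m * y i)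
  have hsub : (y - cubeCenter n m y) i =
      (2:ℝ) ^ (-m) * ((2:ℝ) ^ m * y i - ⌊(2:ℝ) ^ m * y i⌋ - 1 / 2) := by
    rw [Pi.sub_apply, cubeCenter]
    linear_combination hy
  rw [hsub, norm_mul, Real.norm_of_nonneg h2.le, Real.norm_eq_abs, div_eq_mul_inv]
  refine mul_le_mul_of_nonneg_left ?_ h2.le
  rw [abs_le]
  constructor <;> linarith

/-- Points outside the fivefold dilation of the cube containing `y` are at distance at least
twice the side length from `y`. -/
theorem le_norm_sub_of_notMem_dilatedCube {n : ℕ} {j : ℤ} {x y : Fin n → ℝ}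
    (h : x ∉ dilatedCube n 5 j y) : 2 * (2:ℝ) ^ (-j) ≤ ‖x - y‖ := by
  have hx : 5 * (2:ℝ) ^ (-j) / 2 ≤ ‖x - cubeCenter n j y‖ := by
    simpa [dilatedCube] using h
  have hy := norm_sub_cubeCenter_le n j y
  have htri := norm_sub_le_norm_sub_add_norm_sub x y (cubeCenter n j y)
  linarith

/-- Pointwise bound for the difference of a smooth kernel at `y` and at a nearby center. -/
theorem SmoothKernel.norm_sub_cubeCenter_le {n : ℕ} {γ : ℝ} (hγ : 0 ≤ γ)
    {k : (Fin n → ℝ) → (Fin n → ℝ) → ℂ} (hk : SmoothKernel n γ k) {j : ℤ} (s : ℕ)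
    {x y : Fin n → ℝ} (h : x ∉ dilatedCube n 5 j y) :
    ‖k x y - k x (cubeCenter n (j + s - 1) y)‖ ≤
      2 ^ (-(s:ℝ) * γ) * (((2:ℝ) ^ (-j)) ^ γ / ‖x - y‖ ^ ((n:ℝ) + γ)) := by
  have hxy := le_norm_sub_of_notMem_dilatedCube h
  have hc : ‖cubeCenter n (j + s - 1) y - y‖ ≤ (2:ℝ) ^ (-(s:ℝ)) * 2 ^ (-j) := by
    rw [norm_sub_rev]
    refine (_root_.norm_sub_cubeCenter_le n _ y).trans_eq ?_
    rw [← Int.cast_natCast (R := ℝ) s, ← Int.cast_neg, Real.rpow_intCast,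
      ← zpow_add₀ two_ne_zero, div_eq_mul_inv, ← zpow_neg_one, ← zpow_add₀ two_ne_zero]
    congr 1
    ring
  have hs : (2:ℝ) ^ (-(s:ℝ)) ≤ 1 :=
    Real.rpow_le_one_of_one_le_of_nonpos one_le_two (by simp)
  have hpos : (0:ℝ) < 2 ^ (-j) := by positivity
  have hhalf : ‖cubeCenter n (j + s - 1) y - y‖ ≤ 1 / 2 * ‖x - y‖ := by nlinarith
  rw [norm_sub_rev]
  refine (hk _ x y hhalf).2.trans ?_
  rw [← mul_div_assoc, Real.rpow_mul zero_le_two, ← Real.mul_rpow (by positivity) hpos.le]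
  gcongr

/-- The tail integral of `‖a - u‖ ^ (-(n + γ))` at scale `δ` is at most a constant times
`δ ^ (-γ)`. -/
theorem setLIntegral_le_of_le_norm_rpow {n : ℕ} {γ : ℝ} (hγ : 0 < γ) {δ A : ℝ} (hδ : 0 < δ)
    (hA : 0 ≤ A) (a : Fin n → ℝ) {S : Set (Fin n → ℝ)} {f : (Fin n → ℝ) → ℝ≥0∞}
    (hS : ∀ u ∈ S, δ ≤ ‖a - u‖)
    (hf : ∀ u ∈ S, f u ≤ ENNReal.ofReal (A * (δ ^ γ / ‖a - u‖ ^ ((n:ℝ) + γ)))) :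
    ∫⁻ u in S, f u ≤ ENNReal.ofReal
      (A * 2 ^ ((n:ℝ) + γ) * ∫ w : Fin n → ℝ, (1 + ‖w‖) ^ (-((n:ℝ) + γ))) := by
  set r : ℝ := (n:ℝ) + γ with hr
  have hr0 : 0 < r := by positivity
  let g : (Fin n → ℝ) → ℝ := fun w => (1 + ‖w‖) ^ (-r)
  let G : (Fin n → ℝ) → ℝ := fun u => A * 2 ^ r * (δ⁻¹ ^ n * g (δ⁻¹ • (a - u)))
  have hg : Integrable g := integrable_one_add_norm (by simp [hr, hγ])
  have hG : Integrable G :=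
    (((hg.comp_smul (inv_ne_zero hδ.ne')).comp_sub_left a).const_mul _).const_mul _
  have hG0 : ∀ u, 0 ≤ G u := fun u => by positivity
  have hGm : Measurable G := by fun_prop
  have hfG : ∀ u ∈ S, f u ≤ ENNReal.ofReal (G u) := by
    intro u hu
    refine (hf u hu).trans (ENNReal.ofReal_le_ofReal ?_)
    have hau := hS u hu
    have hau0 : 0 < ‖a - u‖ := hδ.trans_le hau
    set t := δ⁻¹ * ‖a - u‖ with ht
    have ht1 : 1 ≤ t := by
      rw [ht, inv_mul_eq_div]
      exact (one_le_div hδ).2 hau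
    have hta : ‖a - u‖ = δ * t := by rw [ht, mul_inv_cancel_left₀ hδ.ne']
    have hnorm : ‖δ⁻¹ • (a - u)‖ = t := by
      rw [norm_smul, Real.norm_of_nonneg (by positivity)]
    have hleft : δ ^ γ / ‖a - u‖ ^ r = δ⁻¹ ^ n * t ^ (-r) := by
      rw [hta, Real.mul_rpow hδ.le (by positivity), Real.rpow_neg (by positivity), hr,
        Real.rpow_add hδ, Real.rpow_natCast, inv_pow]
      have := (Real.rpow_pos_of_pos hδ γ).ne'
      field_simp
    have hcomp : t ^ (-r) ≤ 2 ^ r * (1 + t) ^ (-r) := by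
      have h := Real.rpow_le_rpow_of_nonpos (by positivity) (by linarith : 1 + t ≤ 2 * t)
        (neg_nonpos.2 hr0.le)
      rw [Real.mul_rpow zero_le_two (by positivity), Real.rpow_neg zero_le_two] at h
      rwa [inv_mul_le_iff₀ (by positivity)] at h
    calc A * (δ ^ γ / ‖a - u‖ ^ r) = A * (δ⁻¹ ^ n * t ^ (-r)) := by rw [hleft]
      _ ≤ A * (δ⁻¹ ^ n * (2 ^ r * (1 + t) ^ (-r))) := by gcongr
      _ = G u := by simp only [G, g, hnorm]; ring
  calc ∫⁻ u in S, f u ≤ ∫⁻ u in S, ENNReal.ofReal (G u) :=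
        setLIntegral_mono hGm.ennreal_ofReal hfG
    _ ≤ ∫⁻ u, ENNReal.ofReal (G u) := setLIntegral_le_lintegral _ _
    _ = ENNReal.ofReal (∫ u, G u) :=
        (ofReal_integral_eq_lintegral_ofReal hG (.of_forall hG0)).symm
    _ = ENNReal.ofReal (A * 2 ^ r * ∫ w, g w) := by
        congr 1
        rw [integral_const_mul, integral_const_mul,
          integral_sub_left_eq_self (fun v => g (δ⁻¹ • v)) volume a,
          Measure.integral_comp_smul]
        have : (δ⁻¹ ^ n : ℝ) ≠ 0 := by positivity
        rw [Module.finrank_fin_fun, abs_of_nonneg (by positivity), smul_eq_mul,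
          mul_inv_cancel_left₀ this]

/-- Schur-type integral estimates for the shifted kernel
`k_{j,s}(x,y) = 1_{x ∉ 5Q_{y,j}} (k(x,y) - k(x, c_{y,j+s-1}))`: its `y`-integrals and
`x`-integrals are bounded by `c · 2^{-sγ}` with `c` depending only on `n` and `γ`. -/
theorem schur_estimates_shifted_kernel (n : ℕ) (hn : 1 ≤ n) (γ : ℝ)
    (hγ0 : 0 < γ) (hγ1 : γ ≤ 1) :
    ∃ c : ℝ, 0 < c ∧
      ∀ k : (Fin n → ℝ) → (Fin n → ℝ) → ℂ,
        Measurable (Function.uncurry k) → SmoothKernel n γ k →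
        ∀ (j : ℤ) (s : ℕ),
          (∀ x : Fin n → ℝ,
            ∫⁻ y in {y | x ∉ dilatedCube n 5 j y},
                (‖k x y - k x (cubeCenter n (j + s - 1) y)‖₊ : ℝ≥0∞)
              ≤ ENNReal.ofReal (c * 2 ^ (-(s:ℝ) * γ))) ∧
          (∀ y : Fin n → ℝ,
            ∫⁻ x in {x | x ∉ dilatedCube n 5 j y},
                (‖k x y - k x (cubeCenter n (j + s - 1) y)‖₊ : ℝ≥0∞)
              ≤ ENNReal.ofReal (c * 2 ^ (-(s:ℝ) * γ))) := by
  set I : ℝ := ∫ w : Fin n → ℝ, (1 + ‖w‖) ^ (-((n:ℝ) + γ))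
  have hI : 0 ≤ I := integral_nonneg fun w => by positivity
  refine ⟨2 ^ ((n:ℝ) + γ) * (I + 1), by positivity, fun k _ hk j s => ?_⟩
  have hδ : (0:ℝ) < 2 ^ (-j) := by positivity
  have hconst : ENNReal.ofReal (2 ^ (-(s:ℝ) * γ) * 2 ^ ((n:ℝ) + γ) * I) ≤
      ENNReal.ofReal (2 ^ ((n:ℝ) + γ) * (I + 1) * 2 ^ (-(s:ℝ) * γ)) := by
    rw [mul_comm (2 ^ (-(s:ℝ) * γ)) (2 ^ ((n:ℝ) + γ)), mul_right_comm]
    gcongr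
    exact le_add_of_nonneg_right zero_le_one
  have hdist {x y : Fin n → ℝ} (h : x ∉ dilatedCube n 5 j y) : (2:ℝ) ^ (-j) ≤ ‖x - y‖ := by
    linarith [le_norm_sub_of_notMem_dilatedCube h]
  have hpt {x y : Fin n → ℝ} (h : x ∉ dilatedCube n 5 j y) :
      (‖k x y - k x (cubeCenter n (j + s - 1) y)‖₊ : ℝ≥0∞) ≤
        ENNReal.ofReal (2 ^ (-(s:ℝ) * γ) *
          (((2:ℝ) ^ (-j)) ^ γ / ‖x - y‖ ^ ((n:ℝ) + γ))) := by
    rw [← enorm_eq_nnnorm, ← ofReal_norm]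
    exact ENNReal.ofReal_le_ofReal (hk.norm_sub_cubeCenter_le hγ0.le s h)
  constructor
  · intro x
    exact (setLIntegral_le_of_le_norm_rpow hγ0 hδ (by positivity) x
      (fun y hy => hdist hy) (fun y hy => hpt hy)).trans hconst
  · intro y
    refine (setLIntegral_le_of_le_norm_rpow hγ0 hδ (by positivity) y
      (fun x hx => ?_) (fun x hx => ?_)).trans hconst
    · rw [norm_sub_rev]
      exact hdist hx
    · rw [norm_sub_rev]
      exact hpt hx
end
end

section
/- Double integral estimate across a dyadic cube boundary (Lemma 2.6): let n ≥ 1, γ ∈ (0,1], k ∈ ℤ, and let i ≥ 0 be an integer. Then there is a constant c depending only on n and γ such that for every dyadic cube Q of ℝ^n of generation k − i (i.e. of side length 2^{−(k−i)}), ∫_{t ∈ Q} ∫_{y ∈ ℝ^n ∖ Q} 1_{|t−y| > 2^{1−k}} · |t−y|^{−(n+γ)} dy dt ≤ c (1+i) 2^{(γ−n)(k−i)}. -/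
open MeasureTheory Set
open scoped ENNReal

noncomputable section

/-- The points of `ℝ^n` lying, in some coordinate, within `ρ` inside of one of the two faces of the
cube `∏ i, [b i, b i + L)`, and in the cube in all other coordinates. -/
def boundaryLayer (n : ℕ) (b : Fin n → ℝ) (L ρ : ℝ) : Set (Fin n → ℝ) :=
  ⋃ i, (univ.pi (Function.update (fun j => Ico (b j) (b j + L)) i (Icc (b i) (b i + ρ))) ∪
    univ.pi (Function.update (fun j => Ico (b j) (b j + L)) i (Icc (b i + L - ρ) (b i + L))))

lemma measurableSet_boundaryLayer (n : ℕ) (b : Fin n → ℝ) (L ρ : ℝ) :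
    MeasurableSet (boundaryLayer n b L ρ) := by
  refine MeasurableSet.iUnion fun i => MeasurableSet.union ?_ ?_ <;>
  · refine MeasurableSet.univ_pi fun j => ?_
    rcases eq_or_ne j i with rfl | h
    · simp
    · simp [h]

lemma volume_pi_update_Ico (n : ℕ) (b : Fin n → ℝ) (L : ℝ) (i : Fin n) (s : Set ℝ) :
    volume (univ.pi (Function.update (fun j => Ico (b j) (b j + L)) i s)) =
      volume s * ENNReal.ofReal L ^ (n - 1) := by
  rw [volume_pi_pi, ← Finset.mul_prod_erase _ _ (Finset.mem_univ i)]
  congr 1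
  · simp
  · rw [Finset.prod_congr rfl (g := fun _ => ENNReal.ofReal L)]
    · simp
    · intro j hj
      simp [Finset.ne_of_mem_erase hj]

lemma volume_boundaryLayer_le (n : ℕ) (b : Fin n → ℝ) (L ρ : ℝ) :
    volume (boundaryLayer n b L ρ) ≤
      n * (2 * (ENNReal.ofReal ρ * ENNReal.ofReal L ^ (n - 1))) := by
  calc volume (boundaryLayer n b L ρ)
      ≤ ∑ i : Fin n, 2 * (ENNReal.ofReal ρ * ENNReal.ofReal L ^ (n - 1)) := by
        refine (measure_iUnion_fintype_le _ _).trans (Finset.sum_le_sum fun i _ => ?_)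
        refine (measure_union_le _ _).trans (le_of_eq ?_)
        rw [volume_pi_update_Ico, volume_pi_update_Ico, Real.volume_Icc, Real.volume_Icc, two_mul]
        congr 4 <;> ring
    _ = _ := by simp

lemma mem_boundaryLayer_of_norm_sub_le {n : ℕ} {b : Fin n → ℝ} {L ρ : ℝ} {t y : Fin n → ℝ}
    (ht : t ∈ univ.pi fun j => Ico (b j) (b j + L))
    (hy : y ∉ univ.pi fun j => Ico (b j) (b j + L)) (hty : ‖t - y‖ ≤ ρ) :
    t ∈ boundaryLayer n b L ρ := by
  simp only [mem_univ_pi, not_forall] at ht hy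
  obtain ⟨i, hi⟩ := hy
  have habs := abs_le.1 (((norm_le_pi_norm (t - y) i).trans hty))
  simp only [Pi.sub_apply] at habs
  have hti := ht i
  have key : ∀ s : Set ℝ, t i ∈ s →
      t ∈ univ.pi (Function.update (fun j => Ico (b j) (b j + L)) i s) := by
    intro s hs j _
    rcases eq_or_ne j i with rfl | h
    · simpa using hs
    · simpa [h] using ht j
  refine mem_iUnion.2 ⟨i, ?_⟩
  simp only [mem_Ico, not_and_or, not_le, not_lt] at hi hti
  rcases hi with hi | hi
  · exact Or.inl (key _ ⟨hti.1, by linarith⟩)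
  · exact Or.inr (key _ ⟨by linarith, hti.2.le⟩)

/-- Domination of a truncated power of the distance by a sum over dyadic balls. -/
lemma truncated_rpow_le_tsum_closedBall {E : Type*} [SeminormedAddCommGroup E] {r p : ℝ}
    (hr : 0 < r) (hp : 0 ≤ p) (t y : E) :
    (if r < ‖t - y‖ then ENNReal.ofReal (‖t - y‖ ^ (-p)) else 0) ≤
      ∑' j : ℕ, (Metric.closedBall t (2 * (2 ^ j * r))).indicator
        (fun _ => ENNReal.ofReal ((2 ^ j * r) ^ (-p))) y := by
  split_ifs with h
  · obtain ⟨j, hj1, hj2⟩ := exists_nat_pow_near (one_le_div hr |>.2 h.le) (one_lt_two (α := ℝ))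
    rw [le_div_iff₀ hr] at hj1
    rw [div_lt_iff₀ hr, pow_succ] at hj2
    refine le_trans ?_ (ENNReal.le_tsum j)
    rw [indicator_of_mem]
    · exact ENNReal.ofReal_le_ofReal
        (Real.rpow_le_rpow_of_nonpos (by positivity) hj1 (by linarith))
    · rw [Metric.mem_closedBall, dist_comm, dist_eq_norm]
      linarith
  · exact zero_le

lemma lintegral_compl_cube_le (n : ℕ) {b : Fin n → ℝ} {L r p : ℝ} (hr : 0 < r) (hp : 0 ≤ p)
    {t : Fin n → ℝ} (ht : t ∈ univ.pi fun j => Ico (b j) (b j + L)) :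
    ∫⁻ y in (univ.pi fun j => Ico (b j) (b j + L))ᶜ,
        (if r < ‖t - y‖ then ENNReal.ofReal (‖t - y‖ ^ (-p)) else 0) ≤
      ∑' j : ℕ, (boundaryLayer n b L (2 * (2 ^ j * r))).indicator
        (fun _ => ENNReal.ofReal ((2 ^ j * r) ^ (-p) * (4 * (2 ^ j * r)) ^ n)) t := by
  refine (lintegral_mono fun y => truncated_rpow_le_tsum_closedBall hr hp t y).trans ?_
  rw [lintegral_tsum fun j =>
    (measurable_const.indicator Metric.isClosed_closedBall.measurableSet).aemeasurable]
  refine ENNReal.tsum_le_tsum fun j => ?_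
  rw [lintegral_indicator_const Metric.isClosed_closedBall.measurableSet]
  by_cases hmem : t ∈ boundaryLayer n b L (2 * (2 ^ j * r))
  · rw [indicator_of_mem hmem, ENNReal.ofReal_mul (by positivity)]
    gcongr
    refine (Measure.restrict_apply_le _ _).trans (le_of_eq ?_)
    rw [Real.volume_pi_closedBall _ (by positivity), Fintype.card_fin]
    congr 2
    ring
  · rw [indicator_of_notMem hmem, Measure.restrict_apply Metric.isClosed_closedBall.measurableSet]
    have : Metric.closedBall t (2 * (2 ^ j * r)) ∩ (univ.pi fun j => Ico (b j) (b j + L))ᶜ = ∅ := by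
      refine eq_empty_of_forall_notMem fun y hy => hmem ?_
      refine mem_boundaryLayer_of_norm_sub_le ht hy.2 ?_
      rw [← dist_eq_norm, dist_comm]
      exact hy.1
    simp [this]

lemma lintegral_cube_compl_cube_le (n : ℕ) (b : Fin n → ℝ) {L r p : ℝ} (hr : 0 < r)
    (hp : 0 ≤ p) :
    ∫⁻ t in univ.pi fun j => Ico (b j) (b j + L),
      ∫⁻ y in (univ.pi fun j => Ico (b j) (b j + L))ᶜ,
        (if r < ‖t - y‖ then ENNReal.ofReal (‖t - y‖ ^ (-p)) else 0) ≤
      ∑' j : ℕ, ENNReal.ofReal ((2 ^ j * r) ^ (-p) * (4 * (2 ^ j * r)) ^ n) *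
        min (ENNReal.ofReal L ^ n)
          (n * (2 * (ENNReal.ofReal (2 * (2 ^ j * r)) * ENNReal.ofReal L ^ (n - 1)))) := by
  have hQ : MeasurableSet (univ.pi fun j => Ico (b j) (b j + L)) :=
    MeasurableSet.univ_pi fun _ => measurableSet_Ico
  refine (setLIntegral_mono' hQ fun t ht => lintegral_compl_cube_le n hr hp ht).trans ?_
  rw [lintegral_tsum fun j =>
    (measurable_const.indicator (measurableSet_boundaryLayer _ _ _ _)).aemeasurable]
  refine ENNReal.tsum_le_tsum fun j => ?_
  rw [lintegral_indicator_const (measurableSet_boundaryLayer _ _ _ _)]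
  gcongr
  refine le_min ?_ ((Measure.restrict_apply_le _ _).trans (volume_boundaryLayer_le _ _ _ _))
  refine (measure_mono (subset_univ _)).trans (le_of_eq ?_)
  rw [Measure.restrict_apply_univ, volume_pi_pi]
  simp

lemma rpow_neg_mul_pow_le_of_le {n : ℕ} (hn : 1 ≤ n) {γ L s : ℝ} (hγ1 : γ ≤ 1) (hs : 0 < s)
    (hsL : s ≤ L) :
    s ^ (-((n : ℝ) + γ)) * (4 * s) ^ n * (n * (2 * (2 * s * L ^ (n - 1)))) ≤
      4 ^ n * L ^ ((n : ℝ) - γ) * (4 * n) := by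
  have hL : 0 < L := hs.trans_le hsL
  have h1 : s ^ (-((n : ℝ) + γ)) * s ^ n * s = s ^ (1 - γ) := by
    rw [← Real.rpow_natCast, ← Real.rpow_add hs, ← Real.rpow_add_one hs.ne']
    congr 1
    ring
  have h2 : L ^ (1 - γ) * L ^ (n - 1) = L ^ ((n : ℝ) - γ) := by
    rw [← Real.rpow_natCast, ← Real.rpow_add hL, Nat.cast_sub hn]
    congr 1
    push_cast
    ring
  calc s ^ (-((n : ℝ) + γ)) * (4 * s) ^ n * (n * (2 * (2 * s * L ^ (n - 1))))
      = 4 ^ n * (s ^ (-((n : ℝ) + γ)) * s ^ n * s * L ^ (n - 1)) * (4 * n) := by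
        rw [mul_pow]
        ring
    _ = 4 ^ n * (s ^ (1 - γ) * L ^ (n - 1)) * (4 * n) := by rw [h1]
    _ ≤ 4 ^ n * (L ^ (1 - γ) * L ^ (n - 1)) * (4 * n) := by
        gcongr
    _ = _ := by rw [h2]

lemma rpow_neg_mul_pow_le_geometric {n : ℕ} {γ L : ℝ} (hγ0 : 0 ≤ γ) (hL : 0 < L) (m : ℕ) :
    (2 ^ (m + 1) * L) ^ (-((n : ℝ) + γ)) * (4 * (2 ^ (m + 1) * L)) ^ n * L ^ n ≤
      4 ^ n * L ^ ((n : ℝ) - γ) * ((2 : ℝ) ^ (-γ)) ^ m := by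
  have hs : 0 < 2 ^ (m + 1) * L := by positivity
  have h1 : (2 ^ (m + 1) * L) ^ (-((n : ℝ) + γ)) * (2 ^ (m + 1) * L) ^ n =
      ((2 : ℝ) ^ (-γ)) ^ (m + 1) * L ^ (-γ) := by
    rw [Real.rpow_pow_comm (by norm_num), ← Real.mul_rpow (by positivity) hL.le,
      ← Real.rpow_natCast _ n, ← Real.rpow_add hs]
    congr 1
    ring
  have h2 : L ^ (-γ) * L ^ n = L ^ ((n : ℝ) - γ) := by
    rw [← Real.rpow_natCast, ← Real.rpow_add hL]
    congr 1
    ring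
  have h3 : (2 : ℝ) ^ (-γ) ≤ 1 :=
    Real.rpow_le_one_of_one_le_of_nonpos (by norm_num) (by linarith)
  calc (2 ^ (m + 1) * L) ^ (-((n : ℝ) + γ)) * (4 * (2 ^ (m + 1) * L)) ^ n * L ^ n
      = 4 ^ n * ((2 ^ (m + 1) * L) ^ (-((n : ℝ) + γ)) * (2 ^ (m + 1) * L) ^ n) * L ^ n := by
        rw [mul_pow 4]
        ring
    _ = 4 ^ n * (L ^ (-γ) * L ^ n) * ((2 : ℝ) ^ (-γ)) ^ (m + 1) := by
        rw [h1]
        ring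
    _ ≤ _ := by
        rw [h2]
        exact mul_le_mul_of_nonneg_left
          (pow_le_pow_of_le_one (by positivity) h3 (Nat.le_succ m)) (by positivity)

lemma lintegral_cube_compl_cube_le_rpow {n : ℕ} (hn : 1 ≤ n) (b : Fin n → ℝ) {γ L r : ℝ}
    (hγ0 : 0 < γ) (hγ1 : γ ≤ 1) (hL : 0 < L) (i : ℕ) (hr : 2 ^ i * r = 2 * L) :
    ∫⁻ t in univ.pi fun j => Ico (b j) (b j + L),
      ∫⁻ y in (univ.pi fun j => Ico (b j) (b j + L))ᶜ,
        (if r < ‖t - y‖ then ENNReal.ofReal (‖t - y‖ ^ (-((n : ℝ) + γ))) else 0) ≤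
      ENNReal.ofReal (4 ^ n * (4 * n + (1 - (2 : ℝ) ^ (-γ))⁻¹) * (1 + i) *
        L ^ ((n : ℝ) - γ)) := by
  have hr0 : 0 < r := pos_of_mul_pos_right (hr ▸ by positivity) (by positivity : (0:ℝ) ≤ 2 ^ i)
  have hq1 : (2 : ℝ) ^ (-γ) < 1 := Real.rpow_lt_one_of_one_lt_of_neg (by norm_num) (by linarith)
  have hq0 : 0 ≤ (2 : ℝ) ^ (-γ) := by positivity
  have hG : 0 < (1 - (2 : ℝ) ^ (-γ))⁻¹ := inv_pos.2 (by linarith)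
  refine (lintegral_cube_compl_cube_le n b hr0 (by positivity)).trans ?_
  rw [← Summable.sum_add_tsum_nat_add' (k := i) ENNReal.summable]
  have hnear : ∀ j ∈ Finset.range i,
      ENNReal.ofReal ((2 ^ j * r) ^ (-((n : ℝ) + γ)) * (4 * (2 ^ j * r)) ^ n) *
        min (ENNReal.ofReal L ^ n)
          (n * (2 * (ENNReal.ofReal (2 * (2 ^ j * r)) * ENNReal.ofReal L ^ (n - 1)))) ≤
      ENNReal.ofReal (4 ^ n * L ^ ((n : ℝ) - γ) * (4 * n)) := by
    intro j hj
    have hsL : 2 ^ j * r ≤ L := by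
      have : (2 : ℝ) ^ (j + 1) ≤ 2 ^ i :=
        pow_le_pow_right₀ one_le_two (Finset.mem_range.1 hj)
      have := mul_le_mul_of_nonneg_right this hr0.le
      rw [pow_succ] at this
      linarith
    refine le_trans ?_ (ENNReal.ofReal_le_ofReal
      (rpow_neg_mul_pow_le_of_le hn hγ1 (by positivity : 0 < 2 ^ j * r) hsL))
    rw [ENNReal.ofReal_mul (q := n * (2 * (2 * (2 ^ j * r) * L ^ (n - 1)))) (by positivity)]
    gcongr
    refine (min_le_right _ _).trans (le_of_eq ?_)
    rw [ENNReal.ofReal_mul (p := n) (by positivity),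
      ENNReal.ofReal_mul (q := 2 * (2 ^ j * r) * L ^ (n - 1)) (by positivity),
      ENNReal.ofReal_mul (q := L ^ (n - 1)) (by positivity), ENNReal.ofReal_pow hL.le]
    simp
  have hfar : ∀ m : ℕ,
      ENNReal.ofReal ((2 ^ (m + i) * r) ^ (-((n : ℝ) + γ)) * (4 * (2 ^ (m + i) * r)) ^ n) *
        min (ENNReal.ofReal L ^ n)
          (n * (2 * (ENNReal.ofReal (2 * (2 ^ (m + i) * r)) * ENNReal.ofReal L ^ (n - 1)))) ≤
      ENNReal.ofReal (4 ^ n * L ^ ((n : ℝ) - γ) * ((2 : ℝ) ^ (-γ)) ^ m) := by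
    intro m
    have hs : 2 ^ (m + i) * r = 2 ^ (m + 1) * L := by
      rw [pow_add, mul_assoc, hr]
      ring
    rw [hs]
    refine le_trans ?_ (ENNReal.ofReal_le_ofReal (rpow_neg_mul_pow_le_geometric hγ0.le hL m))
    rw [ENNReal.ofReal_mul (q := L ^ n) (by positivity), ENNReal.ofReal_pow hL.le]
    gcongr
    exact min_le_left _ _
  refine (add_le_add (Finset.sum_le_sum hnear) (ENNReal.tsum_le_tsum hfar)).trans ?_
  rw [← ENNReal.ofReal_tsum_of_nonneg (fun m => by positivity)
      ((summable_geometric_of_lt_one hq0 hq1).mul_left _), tsum_mul_left,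
    tsum_geometric_of_lt_one hq0 hq1, Finset.sum_const, Finset.card_range, ← ENNReal.ofReal_nsmul,
    ← ENNReal.ofReal_add (by positivity) (by positivity)]
  refine ENNReal.ofReal_le_ofReal ?_
  have hA : 0 ≤ 4 ^ n * L ^ ((n : ℝ) - γ) := by positivity
  have hi : (0 : ℝ) ≤ i := by positivity
  have hn0 : (0 : ℝ) ≤ n := by positivity
  calc i • (4 ^ n * L ^ ((n : ℝ) - γ) * (4 * n)) +
        4 ^ n * L ^ ((n : ℝ) - γ) * (1 - (2 : ℝ) ^ (-γ))⁻¹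
      = 4 ^ n * L ^ ((n : ℝ) - γ) * (i * (4 * n) + (1 - (2 : ℝ) ^ (-γ))⁻¹) := by
        rw [nsmul_eq_mul]
        ring
    _ ≤ 4 ^ n * L ^ ((n : ℝ) - γ) * ((4 * n + (1 - (2 : ℝ) ^ (-γ))⁻¹) * (1 + i)) := by
        refine mul_le_mul_of_nonneg_left ?_ hA
        nlinarith [mul_nonneg hG.le hi]
    _ = _ := by ring

lemma dyadicCubeOf_eq_pi (n : ℕ) (m : ℤ) (a : Fin n → ℤ) :
    dyadicCubeOf n m a =
      univ.pi fun j => Ico ((2 : ℝ) ^ (-m) * a j) ((2 : ℝ) ^ (-m) * a j + (2 : ℝ) ^ (-m)) := by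
  ext z
  simp [dyadicCubeOf, mul_add]

/-- Double integral estimate across a dyadic cube boundary:
for every dyadic cube `Q` of generation `k - i`,
`∫_{t ∈ Q} ∫_{y ∉ Q} 1_{|t-y| > 2^{1-k}} |t-y|^{-(n+γ)} dy dt ≤ c (1+i) 2^{(γ-n)(k-i)}`. -/
theorem double_integral_cube_boundary (n : ℕ) (hn : 1 ≤ n) (γ : ℝ)
    (hγ0 : 0 < γ) (hγ1 : γ ≤ 1) :
    ∃ c : ℝ, 0 < c ∧
      ∀ (k : ℤ) (i : ℕ) (a : Fin n → ℤ),
        ∫⁻ t in dyadicCubeOf n (k - i) a,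
          ∫⁻ y in (dyadicCubeOf n (k - i) a)ᶜ,
            (if (2:ℝ) ^ (1 - k) < ‖t - y‖ then
              ENNReal.ofReal (‖t - y‖ ^ (-((n:ℝ) + γ))) else 0)
          ≤ ENNReal.ofReal (c * (1 + i) * 2 ^ ((γ - n) * ((k:ℝ) - i))) := by
  have hq1 : (2 : ℝ) ^ (-γ) < 1 := Real.rpow_lt_one_of_one_lt_of_neg (by norm_num) (by linarith)
  have hG : 0 < (1 - (2 : ℝ) ^ (-γ))⁻¹ := inv_pos.2 (by linarith)
  refine ⟨4 ^ n * (4 * n + (1 - (2 : ℝ) ^ (-γ))⁻¹), by positivity, fun k i a => ?_⟩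
  have hr : (2 : ℝ) ^ i * 2 ^ (1 - k) = 2 * 2 ^ (-(k - i : ℤ)) := by
    rw [← zpow_natCast, ← zpow_add₀ two_ne_zero, ← zpow_one_add₀ two_ne_zero]
    congr 1
    ring
  have hpow : ((2 : ℝ) ^ (-(k - i : ℤ))) ^ ((n : ℝ) - γ) = 2 ^ ((γ - n) * ((k : ℝ) - i)) := by
    rw [← Real.rpow_intCast, ← Real.rpow_mul (by norm_num)]
    congr 1
    push_cast
    ring
  rw [dyadicCubeOf_eq_pi, ← hpow]
  exact lintegral_cube_compl_cube_le_rpow hn _ hγ0 hγ1 (by positivity) i hr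
end
end

section
/- L² estimate for the block operator Φ_i (scalar case of the Φ part of Property 2.5): let n ≥ 1, γ ∈ (0,1], and let k : ℝ^n × ℝ^n → ℂ be a measurable kernel satisfying the size condition and the smoothness estimates with Lipschitz parameter γ. For j ∈ ℤ, define T_j g(x) = ∫_{ℝ^n} 1_{x ∉ 5Q_{y,j}} k(x,y) g(y) dy for g ∈ L²(ℝ^n) (the integral converges absolutely for a.e. x by the size condition). Then for all integers i, s ≥ 0 and every f ∈ L²(ℝ^n), the series Σ_{j ∈ ℤ} Δ_{j+i}(T_j(Δ_{j+s} f)) converges in L²(ℝ^n) and its sum has L² norm at most c · 2^{−γ(i+s)/2} ‖f‖_{L²}, with a constant c depending only on n and γ. -/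
open MeasureTheory Set
open scoped ENNReal

noncomputable section

/-- The integer coordinates of the dyadic cube of generation `m` containing `x`. -/
def dyadicIndex (n : ℕ) (m : ℤ) (x : Fin n → ℝ) : Fin n → ℤ :=
  fun l => ⌊(2:ℝ) ^ m * x l⌋

lemma measurable_dyadicIndex (n : ℕ) (m : ℤ) : Measurable (dyadicIndex n m) := by
  unfold dyadicIndex
  fun_prop

lemma dyadicCube_eq (n : ℕ) (m : ℤ) (y : Fin n → ℝ) :
    dyadicCube n m y = dyadicIndex n m ⁻¹' {dyadicIndex n m y} := by
  ext z
  simp only [dyadicCube, dyadicIndex, mem_ofPred_eq, mem_preimage, mem_singleton_iff, funext_iff]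
  exact forall_congr' fun _ => eq_comm

lemma volume_dyadicIndex_preimage (n : ℕ) (m : ℤ) (a : Fin n → ℤ) :
    volume (dyadicIndex n m ⁻¹' {a}) = ENNReal.ofReal ((2:ℝ) ^ (-(m * (n:ℤ)))) := by
  have h2 : (0:ℝ) < 2 ^ m := by positivity
  have : dyadicIndex n m ⁻¹' {a} =
      Set.pi univ fun l => Ico ((2:ℝ) ^ (-m) * a l) ((2:ℝ) ^ (-m) * (a l + 1)) := by
    ext z
    simp only [dyadicIndex, mem_preimage, mem_singleton_iff, funext_iff, Set.mem_pi, mem_univ,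
      true_imp_iff, mem_Ico, Int.floor_eq_iff, zpow_neg]
    refine forall_congr' fun l => and_congr ?_ ?_
    · rw [inv_mul_le_iff₀ h2]
    · rw [lt_inv_mul_iff₀ h2]
  rw [this, Real.volume_pi_Ico]
  have h3 : ∀ l, (2:ℝ) ^ (-m) * (a l + 1) - (2:ℝ) ^ (-m) * a l = 2 ^ (-m) := fun l => by ring
  simp only [h3, Finset.prod_const, Finset.card_univ, Fintype.card_fin]
  rw [← ENNReal.ofReal_pow (by positivity), ← zpow_natCast, ← zpow_mul, neg_mul]

lemma dyadicIndex_eq_of_le {n : ℕ} {m m' : ℤ} (hm : m' ≤ m) {x z : Fin n → ℝ}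
    (h : dyadicIndex n m x = dyadicIndex n m z) : dyadicIndex n m' x = dyadicIndex n m' z := by
  obtain ⟨d, rfl⟩ := Int.le.dest hm
  have key : ∀ t : ℝ, ⌊(2:ℝ) ^ m' * t⌋ = ⌊(2:ℝ) ^ (m' + d) * t⌋ / ((2 ^ d : ℕ) : ℤ) := by
    intro t
    rw [← Int.floor_div_natCast, zpow_add₀ two_ne_zero]
    congr 1
    push_cast
    rw [zpow_natCast]
    field_simp
  ext l
  have := congrFun h l
  simp only [dyadicIndex] at this ⊢
  rw [key, key, this]

lemma norm_sub_le_of_dyadicIndex_eq {n : ℕ} {m : ℤ} {x z : Fin n → ℝ}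
    (h : dyadicIndex n m x = dyadicIndex n m z) : (2:ℝ) ^ m * ‖x - z‖ ≤ 1 := by
  have h2 : (0:ℝ) < 2 ^ m := by positivity
  rw [mul_comm, ← le_div_iff₀ h2, pi_norm_le_iff_of_nonneg (by positivity)]
  intro l
  rw [le_div_iff₀ h2, Pi.sub_apply, Real.norm_eq_abs, mul_comm, ← abs_of_pos h2, ← abs_mul,
    mul_sub]
  exact (Int.abs_sub_lt_one_of_floor_eq_floor (congrFun h l)).le

/-- The lower-left corner of the dyadic cube of generation `m` containing `x`. -/
def dyadicCorner (n : ℕ) (m : ℤ) (x : Fin n → ℝ) : Fin n → ℝ :=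
  fun l => (2:ℝ) ^ (-m) * dyadicIndex n m x l

lemma dyadicCorner_congr {n : ℕ} {m : ℤ} {x z : Fin n → ℝ}
    (h : dyadicIndex n m x = dyadicIndex n m z) : dyadicCorner n m x = dyadicCorner n m z := by
  ext l
  rw [dyadicCorner, dyadicCorner, h]

lemma dyadicIndex_dyadicCorner (n : ℕ) (m : ℤ) (x : Fin n → ℝ) :
    dyadicIndex n m (dyadicCorner n m x) = dyadicIndex n m x := by
  ext l
  have : (2:ℝ) ^ m * dyadicCorner n m x l = dyadicIndex n m x l := by
    rw [dyadicCorner, ← mul_assoc, ← zpow_add₀ two_ne_zero]; simp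
  rw [dyadicIndex, this, Int.floor_intCast]

/-- A function which only depends on the cubes of generation `m` is measurable. -/
lemma measurable_of_dyadicIndex {n : ℕ} {m : ℤ} {β : Type*} [MeasurableSpace β]
    {h : (Fin n → ℝ) → β}
    (hh : ∀ x z, dyadicIndex n m x = dyadicIndex n m z → h x = h z) : Measurable h := by
  have : h = (fun a : Fin n → ℤ => h fun l => (2:ℝ) ^ (-m) * a l) ∘ dyadicIndex n m := by
    ext1 x
    exact hh _ _ (dyadicIndex_dyadicCorner n m x).symm
  rw [this]
  exact Measurable.of_discrete.comp (measurable_dyadicIndex n m)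

lemma integral_mul_eq_zero_of_dyadicIndex {n : ℕ} {m : ℤ} {h g : (Fin n → ℝ) → ℂ}
    (hh : ∀ x z, dyadicIndex n m x = dyadicIndex n m z → h x = h z)
    (hg : ∀ a, ∫ x in dyadicIndex n m ⁻¹' {a}, g x = 0)
    (hi : Integrable fun x => h x * g x) : ∫ x, h x * g x = 0 := by
  have hU : (⋃ a : Fin n → ℤ, dyadicIndex n m ⁻¹' {a}) = univ := by
    ext x; simp
  rw [← setIntegral_univ, ← hU, integral_iUnion
    (fun a => measurable_dyadicIndex n m (measurableSet_singleton a)) _ (hi.integrableOn)]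
  · refine (tsum_congr fun a => ?_).trans tsum_zero
    have : ∫ x in dyadicIndex n m ⁻¹' {a}, h x * g x =
        ∫ x in dyadicIndex n m ⁻¹' {a}, h (fun l => (2:ℝ) ^ (-m) * a l) * g x := by
      refine setIntegral_congr_fun (measurable_dyadicIndex n m (measurableSet_singleton a)) ?_
      intro x hx
      simp only [mem_preimage, mem_singleton_iff] at hx
      subst hx
      simp only
      rw [hh x _ (dyadicIndex_dyadicCorner n m x).symm]
      rfl
    rw [this, integral_const_mul, hg, mul_zero]
  · intro a b hab
    exact (disjoint_singleton.2 hab).preimage _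

/-- Cubes of generation `j` that are separated by at most one other cube, in every coordinate. -/
def DyadicNear (n : ℕ) (j : ℤ) (x y : Fin n → ℝ) : Prop :=
  ∀ l, |dyadicIndex n j x l - dyadicIndex n j y l| ≤ 2

lemma dyadicNear_comm {n : ℕ} {j : ℤ} {x y : Fin n → ℝ} :
    DyadicNear n j x y ↔ DyadicNear n j y x :=
  forall_congr' fun _ => by rw [abs_sub_comm]

lemma DyadicNear.norm_sub_le {n : ℕ} {j : ℤ} {x y : Fin n → ℝ} (h : DyadicNear n j x y) :
    (2:ℝ) ^ j * ‖x - y‖ ≤ 3 := by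
  have h2 : (0:ℝ) < 2 ^ j := by positivity
  rw [mul_comm, ← le_div_iff₀ h2, pi_norm_le_iff_of_nonneg (by positivity)]
  intro l
  rw [le_div_iff₀ h2, Pi.sub_apply, Real.norm_eq_abs, mul_comm, ← abs_of_pos h2, ← abs_mul,
    mul_sub]
  have := h l
  simp only [dyadicIndex] at this
  have h' : |((⌊(2:ℝ) ^ j * x l⌋ : ℝ)) - ⌊(2:ℝ) ^ j * y l⌋| ≤ 2 := by exact_mod_cast this
  rw [abs_le] at h' ⊢
  have a1 := Int.floor_le ((2:ℝ) ^ j * x l)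
  have a2 := Int.lt_floor_add_one ((2:ℝ) ^ j * x l)
  have a3 := Int.floor_le ((2:ℝ) ^ j * y l)
  have a4 := Int.lt_floor_add_one ((2:ℝ) ^ j * y l)
  constructor <;> linarith

lemma two_le_of_not_dyadicNear {n : ℕ} {j : ℤ} {x y : Fin n → ℝ} (h : ¬ DyadicNear n j x y) :
    2 ≤ (2:ℝ) ^ j * ‖x - y‖ := by
  have h2 : (0:ℝ) < 2 ^ j := by positivity
  simp only [DyadicNear, not_forall, not_le] at h
  obtain ⟨l, hl⟩ := h
  have h1 := norm_le_pi_norm (x - y) l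
  rw [Pi.sub_apply, Real.norm_eq_abs] at h1
  refine le_trans ?_ (mul_le_mul_of_nonneg_left h1 h2.le)
  nth_rw 1 [← abs_of_pos h2]
  rw [← abs_mul, mul_sub]
  simp only [dyadicIndex] at hl
  have h' : 3 ≤ |((⌊(2:ℝ) ^ j * x l⌋ : ℝ)) - ⌊(2:ℝ) ^ j * y l⌋| := by
    exact_mod_cast Int.add_one_le_iff.2 hl
  rw [le_abs] at h' ⊢
  have a1 := Int.floor_le ((2:ℝ) ^ j * x l)
  have a2 := Int.lt_floor_add_one ((2:ℝ) ^ j * x l)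
  have a3 := Int.floor_le ((2:ℝ) ^ j * y l)
  have a4 := Int.lt_floor_add_one ((2:ℝ) ^ j * y l)
  rcases h' with h' | h'
  · left; linarith
  · right; linarith

/-- Off the boundaries of the cubes of generation `j`, the truncation set `5Q_{y,j}` is a union
of dyadic cubes of generation `j`. -/
lemma mem_dilatedCube_iff_dyadicNear {n : ℕ} {j : ℤ} {x y : Fin n → ℝ}
    (hx : ∀ l, (2:ℝ) ^ j * x l ≠ dyadicIndex n j x l) :
    x ∈ dilatedCube n 5 j y ↔ DyadicNear n j x y := by
  have h2 : (0:ℝ) < 2 ^ j := by positivity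
  rw [dilatedCube, mem_ofPred_eq, pi_norm_lt_iff (by positivity)]
  refine forall_congr' fun l => ?_
  have e : (x - cubeCenter n j y) l =
      ((2:ℝ) ^ j * x l - (dyadicIndex n j y l + 1 / 2)) / 2 ^ j := by
    simp only [Pi.sub_apply, cubeCenter, dyadicIndex, zpow_neg]
    field_simp
  rw [e, norm_div, Real.norm_eq_abs, Real.norm_eq_abs, abs_of_pos h2, zpow_neg,
    div_lt_iff₀ h2]
  have e2 : ((5:ℕ):ℝ) * ((2:ℝ) ^ j)⁻¹ / 2 * 2 ^ j = 5 / 2 := by field_simp; norm_num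
  rw [e2]
  have a1 : (dyadicIndex n j x l : ℝ) < (2:ℝ) ^ j * x l :=
    lt_of_le_of_ne (Int.floor_le _) (hx l).symm
  have a2 : (2:ℝ) ^ j * x l < dyadicIndex n j x l + 1 := Int.lt_floor_add_one _
  generalize dyadicIndex n j x l = p at *
  generalize dyadicIndex n j y l = q at *
  rw [abs_lt, abs_le]
  constructor
  · rintro ⟨b1, b2⟩
    have c1 : (q:ℝ) < p + 3 := by linarith
    have c2 : (p:ℝ) < q + 3 := by linarith
    norm_cast at c1 c2
    constructor <;> omega
  · rintro ⟨b1, b2⟩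
    have c1 : ((-2 : ℤ) : ℝ) ≤ ((p - q : ℤ) : ℝ) := by exact_mod_cast b1
    have c2 : ((p - q : ℤ) : ℝ) ≤ ((2:ℤ):ℝ) := by exact_mod_cast b2
    push_cast at c1 c2
    constructor <;> linarith

lemma ae_ne_dyadicIndex (n : ℕ) (j : ℤ) :
    ∀ᵐ x : Fin n → ℝ, ∀ l, (2:ℝ) ^ j * x l ≠ dyadicIndex n j x l := by
  rw [ae_all_iff]
  intro l
  have h2 : (0:ℝ) < 2 ^ j := by positivity
  have : ∀ᵐ x : Fin n → ℝ, ∀ a : ℤ, x l ≠ (2:ℝ) ^ (-j) * a := by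
    rw [ae_all_iff]
    intro a
    exact Measure.ae_eval_ne _ l _
  filter_upwards [this] with x hx h
  apply hx (dyadicIndex n j x l)
  rw [← h, zpow_neg]
  field_simp

/-- Young's inequality for the convolution of a nonnegative integrable function with an `L²`
function. -/
lemma eLpNorm_integral_sub_mul_norm_le {n : ℕ} {φ : (Fin n → ℝ) → ℝ} {g : (Fin n → ℝ) → ℂ}
    (hφm : Measurable φ) (hφ0 : ∀ u, 0 ≤ φ u) (hφ : Integrable φ) (hg : Measurable g) :
    eLpNorm (fun x => ∫ y, φ (x - y) * ‖g y‖) 2 volume ≤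
      ENNReal.ofReal (∫ u, φ u) * eLpNorm g 2 volume := by
  set A := ENNReal.ofReal (∫ u, φ u) with hA
  have hA' : A = ∫⁻ u, ENNReal.ofReal (φ u) :=
    ofReal_integral_eq_lintegral_ofReal hφ (ae_of_all _ hφ0)
  have hpt : ∀ x, ‖∫ y, φ (x - y) * ‖g y‖‖ₑ ^ (2:ℝ) ≤
      A * ∫⁻ y, ENNReal.ofReal (φ (x - y)) * ‖g y‖ₑ ^ (2:ℝ) := by
    intro x
    have h1 : ‖∫ y, φ (x - y) * ‖g y‖‖ₑ ≤
        ∫⁻ y, ((fun y => ENNReal.ofReal (φ (x - y)) ^ (1 / 2 : ℝ)) *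
          fun y => ENNReal.ofReal (φ (x - y)) ^ (1 / 2 : ℝ) * ‖g y‖ₑ) y := by
      refine (enorm_integral_le_lintegral_enorm _).trans (lintegral_mono fun y => ?_)
      simp only [Pi.mul_apply]
      rw [← mul_assoc, ← ENNReal.rpow_add_of_nonneg _ _ (by norm_num) (by norm_num), enorm_mul,
        enorm_norm, Real.enorm_of_nonneg (hφ0 _)]
      norm_num
    have h2 := h1.trans (ENNReal.lintegral_mul_le_Lp_mul_Lq volume
      (Real.HolderConjugate.two_two) (by fun_prop) (by fun_prop))
    have e1 : ∀ t : ℝ≥0∞, (t ^ (1 / 2 : ℝ)) ^ (2:ℝ) = t := fun t => by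
      rw [← ENNReal.rpow_mul]; norm_num
    calc _ ≤ _ := ENNReal.rpow_le_rpow h2 (by norm_num)
      _ = _ := by
        rw [ENNReal.mul_rpow_of_nonneg _ _ (by norm_num), e1, e1, hA']
        simp_rw [ENNReal.mul_rpow_of_nonneg _ _ (show (0:ℝ) ≤ 2 by norm_num), e1]
        rw [lintegral_sub_left_eq_self (fun u => ENNReal.ofReal (φ u)) x]
  have hsum : ∫⁻ x, ‖∫ y, φ (x - y) * ‖g y‖‖ₑ ^ (2:ℝ) ≤ A * (A * ∫⁻ y, ‖g y‖ₑ ^ (2:ℝ)) := by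
    refine (lintegral_mono hpt).trans_eq ?_
    rw [lintegral_const_mul _ (Measurable.lintegral_prod_right' (f := fun p : _ × _ =>
      ENNReal.ofReal (φ (p.1 - p.2)) * ‖g p.2‖ₑ ^ (2:ℝ)) (by fun_prop)),
      lintegral_lintegral_swap (by fun_prop)]
    congr 1
    rw [← lintegral_const_mul _ (by fun_prop)]
    refine lintegral_congr fun y => ?_
    simp only
    rw [lintegral_mul_const _ (by fun_prop), lintegral_sub_right_eq_self
      (fun u => ENNReal.ofReal (φ u)), hA']
  rw [eLpNorm_eq_lintegral_rpow_enorm_toReal (by norm_num) (by norm_num),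
    eLpNorm_eq_lintegral_rpow_enorm_toReal (by norm_num) (by norm_num), ENNReal.toReal_ofNat]
  refine (ENNReal.rpow_le_rpow hsum (by norm_num)).trans_eq ?_
  rw [← mul_assoc, ENNReal.mul_rpow_of_nonneg _ _ (by norm_num), ← sq, ← ENNReal.rpow_natCast,
    ← ENNReal.rpow_mul]
  norm_num

/-- The integrable majorant `R^n (1 + R|u|)^{-(n+γ)}` at scale `1/R`. -/
def decayKernel (n : ℕ) (γ R : ℝ) (u : Fin n → ℝ) : ℝ :=
  R ^ n * (1 + R * ‖u‖) ^ (-((n:ℝ) + γ))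

lemma decayKernel_nonneg (n : ℕ) (γ : ℝ) {R : ℝ} (hR : 0 < R) (u : Fin n → ℝ) :
    0 ≤ decayKernel n γ R u := by
  unfold decayKernel; positivity

lemma measurable_decayKernel (n : ℕ) (γ R : ℝ) : Measurable (decayKernel n γ R) := by
  unfold decayKernel; fun_prop

lemma decayKernel_eq_smul {n : ℕ} {γ R : ℝ} (hR : 0 < R) (u : Fin n → ℝ) :
    decayKernel n γ R u = R ^ n * (1 + ‖R • u‖) ^ (-((n:ℝ) + γ)) := by
  rw [decayKernel, norm_smul, Real.norm_of_nonneg hR.le]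

lemma integrable_decayKernel (n : ℕ) {γ R : ℝ} (hγ : 0 < γ) (hR : 0 < R) :
    Integrable (decayKernel n γ R) := by
  have h : Integrable (fun u : Fin n → ℝ => (1 + ‖u‖) ^ (-((n:ℝ) + γ))) :=
    integrable_one_add_norm (by simpa using hγ)
  exact ((h.comp_smul hR.ne').const_mul (R ^ n)).congr
    (ae_of_all _ fun u => (decayKernel_eq_smul hR u).symm)

/-- The common mass of the kernels `decayKernel n γ R`. -/
def decayMass (n : ℕ) (γ : ℝ) : ℝ := ∫ u : Fin n → ℝ, (1 + ‖u‖) ^ (-((n:ℝ) + γ))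

lemma decayMass_nonneg (n : ℕ) (γ : ℝ) : 0 ≤ decayMass n γ :=
  integral_nonneg fun u => by positivity

lemma integral_decayKernel (n : ℕ) (γ : ℝ) {R : ℝ} (hR : 0 < R) :
    ∫ u, decayKernel n γ R u = decayMass n γ := by
  simp_rw [decayKernel_eq_smul hR]
  rw [integral_const_mul, Measure.integral_comp_smul volume
    (fun u : Fin n → ℝ => (1 + ‖u‖) ^ (-((n:ℝ) + γ))) R, decayMass, smul_eq_mul]
  simp only [Module.finrank_fintype_fun_eq_card, Fintype.card_fin]
  rw [abs_of_pos (by positivity)]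
  field_simp

lemma decayKernel_le_zero {n : ℕ} {γ R : ℝ} (hγ : 0 ≤ γ) (hR : 0 < R) (u : Fin n → ℝ) :
    decayKernel n γ R u ≤ decayKernel n 0 R u := by
  unfold decayKernel
  gcongr
  exact le_add_of_nonneg_right (by positivity)

lemma memLp_decayKernel {n : ℕ} (hn : 1 ≤ n) {R : ℝ} (hR : 0 < R) :
    MemLp (decayKernel n 0 R) 2 := by
  rw [memLp_two_iff_integrable_sq (measurable_decayKernel n 0 R).aestronglyMeasurable]
  refine ((integrable_decayKernel n (γ := n) (by positivity) hR).const_mul (R ^ n)).congr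
    (ae_of_all _ fun u => ?_)
  simp only [decayKernel]
  rw [add_zero, mul_pow, ← Real.rpow_natCast (_ ^ (-(n:ℝ))) 2, ← Real.rpow_mul (by positivity),
    ← mul_assoc, ← sq]
  congr 2
  push_cast
  ring

lemma memLp_decayKernel_sub {n : ℕ} (hn : 1 ≤ n) {R : ℝ} (hR : 0 < R) (x : Fin n → ℝ) :
    MemLp (fun y => decayKernel n 0 R (x - y)) 2 :=
  (memLp_decayKernel hn hR).comp_measurePreserving (Measure.measurePreserving_sub_left volume x)

lemma integrable_decayKernel_sub_mul_norm {n : ℕ} (hn : 1 ≤ n) {γ R : ℝ} (hγ : 0 ≤ γ)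
    (hR : 0 < R) {g : (Fin n → ℝ) → ℂ} (hg : MemLp g 2) (x : Fin n → ℝ) :
    Integrable fun y => decayKernel n γ R (x - y) * ‖g y‖ := by
  have h0 : Integrable fun y => decayKernel n 0 R (x - y) * ‖g y‖ :=
    (memLp_decayKernel_sub hn hR x).integrable_mul hg.norm
  refine h0.mono' ?_ (ae_of_all _ fun y => ?_)
  · exact (((measurable_decayKernel n γ R).comp (by fun_prop)).aestronglyMeasurable).mul
      hg.1.norm
  · rw [Real.norm_of_nonneg (mul_nonneg (decayKernel_nonneg n γ hR _) (norm_nonneg _))]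
    exact mul_le_mul_of_nonneg_right (decayKernel_le_zero hγ hR _) (norm_nonneg _)

lemma decayKernel_neg (n : ℕ) (γ R : ℝ) (u : Fin n → ℝ) :
    decayKernel n γ R (-u) = decayKernel n γ R u := by
  rw [decayKernel, decayKernel, norm_neg]

lemma decayKernel_le_of_norm_sub_le {n : ℕ} {γ R : ℝ} (hγ0 : 0 < γ) (hγ1 : γ ≤ 1) (hR : 0 < R)
    {u v : Fin n → ℝ} (h : R * ‖u - v‖ ≤ 2) :
    decayKernel n γ R u ≤ 3 ^ (n + 1) * decayKernel n γ R v := by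
  have h1 : ‖v‖ ≤ ‖u‖ + ‖u - v‖ := by
    rw [norm_sub_rev]; exact norm_le_norm_add_norm_sub' v u
  have h2 : (1 + R * ‖v‖) / 3 ≤ 1 + R * ‖u‖ := by
    have := mul_le_mul_of_nonneg_left h1 hR.le
    have := mul_nonneg hR.le (norm_nonneg u)
    rw [div_le_iff₀ (by norm_num)]
    linarith
  have h3 : (1 + R * ‖u‖) ^ (-((n:ℝ) + γ)) ≤ 3 ^ (n + 1) * (1 + R * ‖v‖) ^ (-((n:ℝ) + γ)) := by
    calc _ ≤ ((1 + R * ‖v‖) / 3) ^ (-((n:ℝ) + γ)) :=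
          Real.rpow_le_rpow_of_nonpos (by positivity) h2 (by linarith [n.cast_nonneg (α := ℝ)])
      _ = 3 ^ ((n:ℝ) + γ) * (1 + R * ‖v‖) ^ (-((n:ℝ) + γ)) := by
          rw [Real.div_rpow (by positivity) (by norm_num), Real.rpow_neg (by norm_num) (x := 3),
            div_inv_eq_mul, mul_comm]
      _ ≤ _ := by
          gcongr
          rw [← Real.rpow_natCast]
          push_cast
          exact Real.rpow_le_rpow_of_exponent_le (by norm_num) (by linarith)
  unfold decayKernel
  calc _ ≤ R ^ n * (3 ^ (n + 1) * (1 + R * ‖v‖) ^ (-((n:ℝ) + γ))) := by gcongr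
    _ = _ := by ring

/-- The average of `‖g‖` against the majorant at scale `1/R`. -/
def decayAvg (n : ℕ) (γ R : ℝ) (g : (Fin n → ℝ) → ℂ) (x : Fin n → ℝ) : ℝ :=
  ∫ y, decayKernel n γ R (x - y) * ‖g y‖

lemma decayAvg_nonneg (n : ℕ) (γ : ℝ) {R : ℝ} (hR : 0 < R) (g : (Fin n → ℝ) → ℂ)
    (x : Fin n → ℝ) : 0 ≤ decayAvg n γ R g x :=
  integral_nonneg fun _ => mul_nonneg (decayKernel_nonneg n γ hR _) (norm_nonneg _)

lemma eLpNorm_decayAvg_le (n : ℕ) {γ R : ℝ} (hγ : 0 < γ) (hR : 0 < R)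
    {g : (Fin n → ℝ) → ℂ} (hg : Measurable g) :
    eLpNorm (decayAvg n γ R g) 2 volume ≤
      ENNReal.ofReal (decayMass n γ) * eLpNorm g 2 volume := by
  rw [← integral_decayKernel n γ hR]
  exact eLpNorm_integral_sub_mul_norm_le (measurable_decayKernel n γ R)
    (decayKernel_nonneg n γ hR) (integrable_decayKernel n hγ hR) hg

lemma decayAvg_le_of_norm_sub_le {n : ℕ} (hn : 1 ≤ n) {γ R : ℝ} (hγ0 : 0 < γ) (hγ1 : γ ≤ 1)
    (hR : 0 < R) {g : (Fin n → ℝ) → ℂ} (hg : MemLp g 2) {u x : Fin n → ℝ}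
    (h : R * ‖u - x‖ ≤ 2) :
    decayAvg n γ R g u ≤ 3 ^ (n + 1) * decayAvg n γ R g x := by
  unfold decayAvg
  rw [← integral_const_mul]
  refine integral_mono (integrable_decayKernel_sub_mul_norm hn hγ0.le hR hg u)
    ((integrable_decayKernel_sub_mul_norm hn hγ0.le hR hg x).const_mul _) fun y => ?_
  simp only
  rw [← mul_assoc]
  refine mul_le_mul_of_nonneg_right ?_ (norm_nonneg _)
  exact decayKernel_le_of_norm_sub_le hγ0 hγ1 hR (by simpa using h)

lemma memLp_of_norm_le_decayAvg {n : ℕ} {γ R C : ℝ} (hγ : 0 < γ) (hR : 0 < R)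
    {g F : (Fin n → ℝ) → ℂ} (hgm : Measurable g) (hg : MemLp g 2) (hF : AEStronglyMeasurable F)
    (h : ∀ᵐ x, ‖F x‖ ≤ C * decayAvg n γ R g x) : MemLp F 2 := by
  refine ⟨hF, (eLpNorm_le_mul_eLpNorm_of_ae_le_mul (p := 2) (c := C)
    (g := decayAvg n γ R g) ?_).trans_lt ?_⟩
  · filter_upwards [h] with x hx
    rwa [Real.norm_of_nonneg (decayAvg_nonneg n γ hR g x)]
  · exact ENNReal.mul_lt_top ENNReal.ofReal_lt_top ((eLpNorm_decayAvg_le n hγ hR hgm).trans_lt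
      (ENNReal.mul_lt_top ENNReal.ofReal_lt_top hg.2))

open Classical in
/-- The kernel `k` truncated off the neighbouring cubes of generation `j`. -/
def truncKernel (n : ℕ) (j : ℤ) (k : (Fin n → ℝ) → (Fin n → ℝ) → ℂ) (x y : Fin n → ℝ) : ℂ :=
  if DyadicNear n j x y then 0 else k x y

lemma truncKernel_swap (n : ℕ) (j : ℤ) (k : (Fin n → ℝ) → (Fin n → ℝ) → ℂ) (x y : Fin n → ℝ) :
    truncKernel n j (fun a b => k b a) y x = truncKernel n j k x y := by
  by_cases h : DyadicNear n j x y
  · simp [truncKernel, h, dyadicNear_comm.1 h]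
  · simp [truncKernel, h, dyadicNear_comm.not.1 h]

lemma SizeKernel.swap {n : ℕ} {k : (Fin n → ℝ) → (Fin n → ℝ) → ℂ} (h : SizeKernel n k) :
    SizeKernel n fun a b => k b a := fun x y hxy => by
  rw [norm_sub_rev]; exact h y x hxy.symm

lemma SmoothKernel.swap {n : ℕ} {γ : ℝ} {k : (Fin n → ℝ) → (Fin n → ℝ) → ℂ}
    (h : SmoothKernel n γ k) : SmoothKernel n γ fun a b => k b a :=
  fun x y z hxz => (h x y z hxz).symm

lemma norm_truncKernel_le {n : ℕ} {j : ℤ} {k : (Fin n → ℝ) → (Fin n → ℝ) → ℂ}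
    (hk : SizeKernel n k) (x y : Fin n → ℝ) :
    ‖truncKernel n j k x y‖ ≤ 2 ^ n * decayKernel n 0 (2 ^ j) (x - y) := by
  have hR : (0:ℝ) < 2 ^ j := by positivity
  unfold truncKernel
  split_ifs with h
  · rw [norm_zero]
    exact mul_nonneg (by positivity) (decayKernel_nonneg n 0 hR _)
  have h2 := two_le_of_not_dyadicNear h
  have hpos : 0 < ‖x - y‖ := pos_of_mul_pos_right (by linarith) hR.le
  refine (hk x y (sub_ne_zero.1 (norm_pos_iff.1 hpos))).trans ?_
  rw [decayKernel, add_zero, Real.rpow_neg (by positivity), Real.rpow_neg (by positivity),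
    Real.rpow_natCast, Real.rpow_natCast, ← mul_assoc, ← mul_pow, ← div_eq_mul_inv, ← div_pow,
    ← inv_pow]
  refine pow_le_pow_left₀ (by positivity) ?_ n
  rw [inv_eq_one_div, div_le_div_iff₀ hpos (by positivity)]
  linarith

/-- The decay estimate at distance at least `1/R`. -/
lemma rpow_div_rpow_le_decayKernel {n : ℕ} {γ R δ : ℝ} (hγ0 : 0 < γ) (hγ1 : γ ≤ 1) (hR : 0 < R)
    (hδ : 0 ≤ δ) {u : Fin n → ℝ} {d : ℝ} (hd : R * d ≤ 2 * δ) (hd0 : 0 ≤ d) (hu : 1 ≤ R * ‖u‖) :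
    d ^ γ / ‖u‖ ^ ((n:ℝ) + γ) ≤ 2 ^ (n + 2) * δ ^ γ * decayKernel n γ R u := by
  have hn : (0:ℝ) ≤ n := n.cast_nonneg
  have hu0 : 0 < ‖u‖ := pos_of_mul_pos_right (by linarith) hR.le
  have h1 : d ^ γ ≤ 2 * δ ^ γ / R ^ γ := by
    calc d ^ γ ≤ (2 * δ / R) ^ γ := by
          apply Real.rpow_le_rpow hd0 _ hγ0.le
          rw [le_div_iff₀ hR]; linarith
      _ = 2 ^ γ * δ ^ γ / R ^ γ := by
          rw [Real.div_rpow (by positivity) hR.le, Real.mul_rpow (by norm_num) hδ]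
      _ ≤ _ := by
          gcongr
          simpa using Real.rpow_le_rpow_of_exponent_le (x := 2) (by norm_num) hγ1
  have h2 : (1 + R * ‖u‖) ^ ((n:ℝ) + γ) ≤ 2 ^ (n + 1) * R ^ n * R ^ γ * ‖u‖ ^ ((n:ℝ) + γ) := by
    calc (1 + R * ‖u‖) ^ ((n:ℝ) + γ) ≤ (2 * R * ‖u‖) ^ ((n:ℝ) + γ) :=
          Real.rpow_le_rpow (by positivity) (by linarith) (by positivity)
      _ = 2 ^ ((n:ℝ) + γ) * (R ^ n * R ^ γ) * ‖u‖ ^ ((n:ℝ) + γ) := by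
          rw [Real.mul_rpow (by positivity) hu0.le, Real.mul_rpow (by norm_num) hR.le,
            Real.rpow_add hR, Real.rpow_natCast]
      _ ≤ 2 ^ (n + 1) * (R ^ n * R ^ γ) * ‖u‖ ^ ((n:ℝ) + γ) := by
          gcongr
          rw [← Real.rpow_natCast]
          push_cast
          exact Real.rpow_le_rpow_of_exponent_le (by norm_num) (by linarith)
      _ = _ := by ring
  rw [decayKernel, Real.rpow_neg (by positivity)]
  calc d ^ γ / ‖u‖ ^ ((n:ℝ) + γ) ≤ (2 * δ ^ γ / R ^ γ) / ‖u‖ ^ ((n:ℝ) + γ) := by gcongr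
    _ ≤ (2 * δ ^ γ / R ^ γ) *
        ((2 ^ (n + 1) * R ^ n * R ^ γ) / (1 + R * ‖u‖) ^ ((n:ℝ) + γ)) := by
        rw [div_eq_mul_one_div]
        refine mul_le_mul_of_nonneg_left ?_ (by positivity)
        rw [div_le_div_iff₀ (by positivity) (by positivity)]
        linarith
    _ = _ := by
        have : R ^ γ ≠ 0 := by positivity
        field_simp
        ring

lemma norm_truncKernel_sub_le {n : ℕ} {γ : ℝ} (hγ0 : 0 < γ) (hγ1 : γ ≤ 1) {j : ℤ} {s : ℕ}
    {k : (Fin n → ℝ) → (Fin n → ℝ) → ℂ} (hk : SizeKernel n k) (hs : SmoothKernel n γ k)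
    (x : Fin n → ℝ) {y y' : Fin n → ℝ}
    (hy : dyadicIndex n (j + s - 1) y = dyadicIndex n (j + s - 1) y') :
    ‖truncKernel n j k x y - truncKernel n j k x y'‖ ≤
      4 * 9 ^ (n + 1) * 2 ^ (-γ * s) * decayKernel n γ (2 ^ j) (x - y) := by
  have hR : (0:ℝ) < 2 ^ j := by positivity
  set R : ℝ := 2 ^ j with hRdef
  have hD := decayKernel_nonneg n γ hR (x - y)
  have hd : R * ‖y' - y‖ ≤ 2 * (2:ℝ) ^ (-(s:ℝ)) := by
    have h := norm_sub_le_of_dyadicIndex_eq hy.symm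
    rw [add_sub_assoc, zpow_add₀ two_ne_zero, zpow_sub_one₀ two_ne_zero, zpow_natCast,
      ← hRdef] at h
    rw [Real.rpow_neg (by norm_num), Real.rpow_natCast]
    have : (0:ℝ) < 2 ^ s := by positivity
    field_simp
    field_simp at h
    linarith
  have hs1 : (2:ℝ) ^ (-(s:ℝ)) ≤ 1 := Real.rpow_le_one_of_one_le_of_nonpos (by norm_num) (by simp)
  have hδ : ((2:ℝ) ^ (-(s:ℝ))) ^ γ = 2 ^ (-γ * s) := by
    rw [← Real.rpow_mul (by norm_num)]; congr 1; ring
  have hsm : ¬ DyadicNear n j x y → ¬ DyadicNear n j x y' → ‖y' - y‖ ≤ 1 / 2 * ‖x - y‖ →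
      ‖truncKernel n j k x y - truncKernel n j k x y'‖ ≤
        4 * 9 ^ (n + 1) * 2 ^ (-γ * s) * decayKernel n γ R (x - y) := by
    intro h h' hle
    rw [truncKernel, truncKernel, if_neg h, if_neg h', norm_sub_rev]
    refine ((hs y' x y hle).2.trans (rpow_div_rpow_le_decayKernel hγ0 hγ1 hR
      (by positivity) hd (norm_nonneg _)
      (by linarith [two_le_of_not_dyadicNear h]))).trans ?_
    rw [hδ]
    gcongr
    rw [pow_add, pow_add]
    have : (2:ℝ) ^ n ≤ 9 ^ n := by gcongr; norm_num
    nlinarith [show (0:ℝ) < 2 ^ n by positivity]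
  by_cases hfar : 8 ≤ R * ‖x - y‖
  · have hle : ‖y' - y‖ ≤ 1 / 2 * ‖x - y‖ := by
      refine le_of_mul_le_mul_left ?_ hR
      linarith
    refine hsm (fun h => ?_) (fun h => ?_) hle
    · linarith [h.norm_sub_le]
    · have h1 : ‖x - y‖ ≤ ‖x - y'‖ + ‖y' - y‖ := norm_sub_le_norm_sub_add_norm_sub x y' y
      have := mul_le_mul_of_nonneg_left h1 hR.le
      linarith [h.norm_sub_le]
  push Not at hfar
  obtain rfl | hs0 := Nat.eq_zero_or_pos s
  · have hb : ∀ z, ‖truncKernel n j k x z‖ ≤ R ^ n := by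
      intro z
      unfold truncKernel
      split_ifs with h
      · rw [norm_zero]; positivity
      have h2 := two_le_of_not_dyadicNear h
      have hpos : 0 < ‖x - z‖ := pos_of_mul_pos_right (by linarith) hR.le
      refine (hk x z (sub_ne_zero.1 (norm_pos_iff.1 hpos))).trans ?_
      rw [Real.rpow_neg hpos.le, Real.rpow_natCast, ← inv_pow]
      refine pow_le_pow_left₀ (by positivity) ?_ n
      rw [inv_le_iff_one_le_mul₀ hpos]
      linarith
    have h9 : 1 ≤ 9 ^ (n + 1) * (1 + R * ‖x - y‖) ^ (-((n:ℝ) + γ)) := by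
      have hn : (0:ℝ) ≤ n := n.cast_nonneg
      rw [Real.rpow_neg (by positivity), ← div_eq_mul_inv, one_le_div (by positivity)]
      calc (1 + R * ‖x - y‖) ^ ((n:ℝ) + γ) ≤ 9 ^ ((n:ℝ) + γ) :=
            Real.rpow_le_rpow (by positivity) (by linarith) (by positivity)
        _ ≤ 9 ^ ((n + 1 : ℕ) : ℝ) := by
            push_cast
            exact Real.rpow_le_rpow_of_exponent_le (by norm_num) (by linarith)
        _ = _ := Real.rpow_natCast _ _
    refine (norm_sub_le _ _).trans ?_
    have hRn : 0 < R ^ n := by positivity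
    rw [decayKernel]
    simp only [Nat.cast_zero, mul_zero, Real.rpow_zero, mul_one]
    nlinarith [hb y, hb y', mul_le_mul_of_nonneg_left h9 hRn.le]
  · have hj : dyadicIndex n j y = dyadicIndex n j y' := dyadicIndex_eq_of_le (by omega) hy
    have hiff : DyadicNear n j x y ↔ DyadicNear n j x y' := by rw [DyadicNear, hj]; rfl
    by_cases h : DyadicNear n j x y
    · rw [truncKernel, truncKernel, if_pos h, if_pos (hiff.1 h), sub_zero, norm_zero]
      positivity
    · refine hsm h (hiff.not.1 h) ?_
      have h2 := two_le_of_not_dyadicNear h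
      have hj1 := norm_sub_le_of_dyadicIndex_eq hj.symm
      refine le_of_mul_le_mul_left ?_ hR
      linarith

lemma dyadicAvg_eq (n : ℕ) (m : ℤ) (h : (Fin n → ℝ) → ℂ) (x : Fin n → ℝ) :
    dyadicAvg n m h x =
      (2:ℝ) ^ (m * (n:ℤ)) • ∫ t in dyadicIndex n m ⁻¹' {dyadicIndex n m x}, h t := by
  rw [dyadicAvg, dyadicCube_eq]

lemma dyadicAvg_congr {n : ℕ} {m : ℤ} (h : (Fin n → ℝ) → ℂ) {x z : Fin n → ℝ}
    (hxz : dyadicIndex n m x = dyadicIndex n m z) : dyadicAvg n m h x = dyadicAvg n m h z := by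
  rw [dyadicAvg_eq, dyadicAvg_eq, hxz]

lemma dyadicDiff_congr {n : ℕ} {m : ℤ} (h : (Fin n → ℝ) → ℂ) {x z : Fin n → ℝ}
    (hxz : dyadicIndex n m x = dyadicIndex n m z) : dyadicDiff n m h x = dyadicDiff n m h z := by
  rw [dyadicDiff, dyadicDiff, dyadicAvg_congr h hxz,
    dyadicAvg_congr h (dyadicIndex_eq_of_le (sub_le_self m zero_le_one) hxz)]

lemma dyadicDiff_congr_ae {n : ℕ} {m : ℤ} {h h' : (Fin n → ℝ) → ℂ} (hh : h =ᵐ[volume] h') :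
    dyadicDiff n m h = dyadicDiff n m h' := by
  ext x
  simp only [dyadicDiff, dyadicAvg]
  rw [integral_congr_ae (ae_restrict_of_ae hh), integral_congr_ae (ae_restrict_of_ae hh)]

lemma measurable_dyadicAvg (n : ℕ) (m : ℤ) (h : (Fin n → ℝ) → ℂ) :
    Measurable (dyadicAvg n m h) :=
  measurable_of_dyadicIndex fun _ _ => dyadicAvg_congr h

lemma measurable_dyadicDiff (n : ℕ) (m : ℤ) (h : (Fin n → ℝ) → ℂ) :
    Measurable (dyadicDiff n m h) :=
  measurable_of_dyadicIndex fun _ _ => dyadicDiff_congr h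

lemma measurableSet_dyadicIndex_preimage (n : ℕ) (m : ℤ) (a : Fin n → ℤ) :
    MeasurableSet (dyadicIndex n m ⁻¹' {a}) :=
  measurable_dyadicIndex n m (measurableSet_singleton a)

lemma volume_real_dyadicIndex_preimage (n : ℕ) (m : ℤ) (a : Fin n → ℤ) :
    volume.real (dyadicIndex n m ⁻¹' {a}) = ((2:ℝ) ^ (m * (n:ℤ)))⁻¹ := by
  rw [Measure.real, volume_dyadicIndex_preimage, ENNReal.toReal_ofReal (by positivity), zpow_neg]

lemma volume_dyadicIndex_preimage_lt_top (n : ℕ) (m : ℤ) (a : Fin n → ℤ) :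
    volume (dyadicIndex n m ⁻¹' {a}) < ∞ := by
  rw [volume_dyadicIndex_preimage]; exact ENNReal.ofReal_lt_top

lemma MeasureTheory.MemLp.integrableOn_dyadicIndex_preimage {n : ℕ} {h : (Fin n → ℝ) → ℂ}
    (hh : MemLp h 2) (m : ℤ) (a : Fin n → ℤ) : IntegrableOn h (dyadicIndex n m ⁻¹' {a}) := by
  have : IsFiniteMeasure (volume.restrict (dyadicIndex n m ⁻¹' {a})) :=
    ⟨by simpa using volume_dyadicIndex_preimage_lt_top n m a⟩
  exact (hh.restrict _).integrable one_le_two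

lemma norm_dyadicAvg_sub_le {n : ℕ} {m : ℤ} {h : (Fin n → ℝ) → ℂ} {x : Fin n → ℝ} {c : ℂ}
    {B : ℝ} (hh : MemLp h 2)
    (hB : ∀ u, dyadicIndex n m u = dyadicIndex n m x → ‖h u - c‖ ≤ B) :
    ‖dyadicAvg n m h x - c‖ ≤ B := by
  have hv := volume_dyadicIndex_preimage_lt_top n m (dyadicIndex n m x)
  have h2 : (0:ℝ) < 2 ^ (m * (n:ℤ)) := by positivity
  have e : dyadicAvg n m h x - c = (2:ℝ) ^ (m * (n:ℤ)) •
      ∫ t in dyadicIndex n m ⁻¹' {dyadicIndex n m x}, (h t - c) := by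
    rw [integral_sub (hh.integrableOn_dyadicIndex_preimage m _)
      (integrableOn_const hv.ne), smul_sub, ← dyadicAvg_eq, setIntegral_const,
      volume_real_dyadicIndex_preimage, smul_smul, mul_inv_cancel₀ h2.ne', one_smul]
  rw [e, norm_smul, Real.norm_of_nonneg h2.le]
  have := norm_setIntegral_le_of_norm_le_const hv (f := fun t => h t - c) (C := B)
    (fun u hu => hB u hu)
  rw [volume_real_dyadicIndex_preimage, ← div_eq_mul_inv, le_div_iff₀ h2] at this
  linarith

lemma norm_dyadicAvg_le_decayAvg {n : ℕ} (hn : 1 ≤ n) (m : ℤ) {h : (Fin n → ℝ) → ℂ}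
    (hh : MemLp h 2) (x : Fin n → ℝ) :
    ‖dyadicAvg n m h x‖ ≤ 2 ^ (n + 1) * decayAvg n 1 (2 ^ m) h x := by
  have hR : (0:ℝ) < 2 ^ m := by positivity
  have hi := integrable_decayKernel_sub_mul_norm hn zero_le_one hR hh x
  have hm := measurableSet_dyadicIndex_preimage n m (dyadicIndex n m x)
  rw [dyadicAvg_eq, norm_smul, Real.norm_of_nonneg (by positivity), decayAvg, ← integral_const_mul]
  calc _ ≤ (2:ℝ) ^ (m * (n:ℤ)) *
        ∫ t in dyadicIndex n m ⁻¹' {dyadicIndex n m x}, ‖h t‖ := by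
        gcongr; exact norm_integral_le_integral_norm _
    _ = ∫ t in dyadicIndex n m ⁻¹' {dyadicIndex n m x}, (2:ℝ) ^ (m * (n:ℤ)) * ‖h t‖ :=
        (integral_const_mul _ _).symm
    _ ≤ ∫ t in dyadicIndex n m ⁻¹' {dyadicIndex n m x},
          2 ^ (n + 1) * (decayKernel n 1 (2 ^ m) (x - t) * ‖h t‖) := by
        refine setIntegral_mono_on
          ((hh.integrableOn_dyadicIndex_preimage m _).norm.const_mul _)
          (hi.const_mul _).integrableOn hm fun t ht => ?_
        rw [← mul_assoc]
        refine mul_le_mul_of_nonneg_right ?_ (norm_nonneg _)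
        have hxt := norm_sub_le_of_dyadicIndex_eq (Eq.symm ht : dyadicIndex n m x = _)
        have e : (-((n:ℝ) + 1)) = -((n + 1 : ℕ) : ℝ) := by push_cast; ring
        rw [decayKernel, e, Real.rpow_neg (by positivity), Real.rpow_natCast, zpow_mul,
          zpow_natCast, ← mul_assoc, mul_comm (2 ^ (n + 1)), mul_assoc]
        refine le_mul_of_one_le_right (by positivity) ?_
        rw [← div_eq_mul_inv, one_le_div (by positivity)]
        exact pow_le_pow_left₀ (by positivity) (by linarith) _
    _ ≤ _ := setIntegral_le_integral (hi.const_mul _) (ae_of_all _ fun t =>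
        mul_nonneg (by positivity) (mul_nonneg (decayKernel_nonneg n 1 hR _) (norm_nonneg _)))

lemma memLp_dyadicAvg {n : ℕ} (hn : 1 ≤ n) (m : ℤ) {h : (Fin n → ℝ) → ℂ} (hm : Measurable h)
    (hh : MemLp h 2) : MemLp (dyadicAvg n m h) 2 :=
  memLp_of_norm_le_decayAvg one_pos (by positivity) hm hh
    (measurable_dyadicAvg n m h).aestronglyMeasurable
    (ae_of_all _ (norm_dyadicAvg_le_decayAvg hn m hh))

lemma memLp_dyadicDiff {n : ℕ} (hn : 1 ≤ n) (m : ℤ) {h : (Fin n → ℝ) → ℂ} (hm : Measurable h)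
    (hh : MemLp h 2) : MemLp (dyadicDiff n m h) 2 :=
  (memLp_dyadicAvg hn m hm hh).sub (memLp_dyadicAvg hn (m - 1) hm hh)

lemma setIntegral_dyadicAvg (n : ℕ) (m : ℤ) (h : (Fin n → ℝ) → ℂ) (a : Fin n → ℤ) :
    ∫ x in dyadicIndex n m ⁻¹' {a}, dyadicAvg n m h x = ∫ x in dyadicIndex n m ⁻¹' {a}, h x := by
  have h2 : (0:ℝ) < 2 ^ (m * (n:ℤ)) := by positivity
  rw [setIntegral_congr_fun (g := fun _ => (2:ℝ) ^ (m * (n:ℤ)) •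
    ∫ t in dyadicIndex n m ⁻¹' {a}, h t) (measurableSet_dyadicIndex_preimage n m a),
    setIntegral_const, volume_real_dyadicIndex_preimage, smul_smul, inv_mul_cancel₀ h2.ne', one_smul]
  intro x hx
  simp only [mem_preimage, mem_singleton_iff] at hx
  simp only [dyadicAvg_eq, hx]

lemma setIntegral_sub_dyadicAvg {n : ℕ} (hn : 1 ≤ n) (m : ℤ) {h : (Fin n → ℝ) → ℂ}
    (hm : Measurable h) (hh : MemLp h 2) (a : Fin n → ℤ) :
    ∫ x in dyadicIndex n m ⁻¹' {a}, (h x - dyadicAvg n m h x) = 0 := by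
  rw [integral_sub (hh.integrableOn_dyadicIndex_preimage m a)
    ((memLp_dyadicAvg hn m hm hh).integrableOn_dyadicIndex_preimage m a),
    setIntegral_dyadicAvg, sub_self]

lemma setIntegral_dyadicDiff {n : ℕ} (hn : 1 ≤ n) (m : ℤ) {h : (Fin n → ℝ) → ℂ}
    (hm : Measurable h) (hh : MemLp h 2) (a : Fin n → ℤ) :
    ∫ x in dyadicIndex n (m - 1) ⁻¹' {a}, dyadicDiff n m h x = 0 := by
  have hs := measurableSet_dyadicIndex_preimage n (m - 1) a
  have hE := memLp_dyadicAvg hn m hm hh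
  have key : ∫ x in dyadicIndex n (m - 1) ⁻¹' {a}, (h x - dyadicAvg n m h x) = 0 := by
    have e : ∀ x, (dyadicIndex n (m - 1) ⁻¹' {a}).indicator (fun x => h x - dyadicAvg n m h x) x =
        (dyadicIndex n (m - 1) ⁻¹' {a}).indicator (fun _ => (1:ℂ)) x *
          (h x - dyadicAvg n m h x) := fun x => by
      simp only [indicator]; split_ifs <;> simp
    rw [← integral_indicator hs, integral_congr_ae (ae_of_all _ e)]
    refine integral_mul_eq_zero_of_dyadicIndex (m := m) (fun x z hxz => ?_)
      (setIntegral_sub_dyadicAvg hn m hm hh) (Integrable.congr ?_ (ae_of_all _ e))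
    · have := dyadicIndex_eq_of_le (sub_le_self m zero_le_one) hxz
      simp only [indicator, mem_preimage, mem_singleton_iff, this]
    · exact ((hh.sub hE).integrableOn_dyadicIndex_preimage (m - 1) a).integrable_indicator hs
  have hi := fun {u : (Fin n → ℝ) → ℂ} (hu : MemLp u 2) =>
    hu.integrableOn_dyadicIndex_preimage (m - 1) a
  rw [integral_sub (hi hh) (hi hE), sub_eq_zero] at key
  simp only [dyadicDiff]
  rw [integral_sub (hi hE) (hi (memLp_dyadicAvg hn (m - 1) hm hh)), ← key,
    setIntegral_dyadicAvg, sub_self]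

lemma inner_toLp_eq_zero_of_dyadicIndex {n : ℕ} {m : ℤ} {u v : (Fin n → ℝ) → ℂ}
    (hu : MemLp u 2) (hv : MemLp v 2)
    (hc : ∀ x z, dyadicIndex n m x = dyadicIndex n m z → u x = u z)
    (h0 : ∀ a, ∫ x in dyadicIndex n m ⁻¹' {a}, v x = 0) :
    inner ℂ (hu.toLp u) (hv.toLp v) = 0 := by
  have e : (fun x => inner ℂ (hu.toLp u x) (hv.toLp v x)) =ᵐ[volume]
      fun x => (starRingEnd ℂ) (u x) * v x := by
    filter_upwards [hu.coeFn_toLp, hv.coeFn_toLp] with x h1 h2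
    rw [h1, h2, RCLike.inner_apply, mul_comm]
  rw [L2.inner_def, integral_congr_ae e]
  refine integral_mul_eq_zero_of_dyadicIndex (m := m)
    (fun x z hxz => congrArg (starRingEnd ℂ) (hc x z hxz)) h0 ?_
  exact (L2.integrable_inner (𝕜 := ℂ) (hu.toLp u) (hv.toLp v)).congr e

lemma inner_dyadicDiff_eq_zero {n : ℕ} (hn : 1 ≤ n) {m m' : ℤ} (hmm : m ≠ m')
    {h h' : (Fin n → ℝ) → ℂ} (hm : Measurable h) (hh : MemLp h 2) (hm' : Measurable h')
    (hh' : MemLp h' 2) :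
    inner ℂ ((memLp_dyadicDiff hn m hm hh).toLp _) ((memLp_dyadicDiff hn m' hm' hh').toLp _) = 0 := by
  rcases lt_or_gt_of_ne hmm with hlt | hlt
  · exact inner_toLp_eq_zero_of_dyadicIndex _ _ (m := m' - 1)
      (fun x z hxz => dyadicDiff_congr h (dyadicIndex_eq_of_le (by omega) hxz))
      (setIntegral_dyadicDiff hn m' hm' hh')
  · rw [inner_eq_zero_symm]
    exact inner_toLp_eq_zero_of_dyadicIndex _ _ (m := m - 1)
      (fun x z hxz => dyadicDiff_congr h' (dyadicIndex_eq_of_le (by omega) hxz))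
      (setIntegral_dyadicDiff hn m hm hh)

lemma inner_dyadicDiff_sub_eq_zero {n : ℕ} (hn : 1 ≤ n) (m : ℤ)
    {h : (Fin n → ℝ) → ℂ} (hm : Measurable h) (hh : MemLp h 2 volume) :
    inner ℂ ((memLp_dyadicDiff hn m hm hh).toLp _)
      (hh.toLp h - (memLp_dyadicDiff hn m hm hh).toLp _) = 0 := by
  have hE := memLp_dyadicAvg hn m hm hh
  have hE' := memLp_dyadicAvg hn (m - 1) hm hh
  have hs : MemLp (fun x => h x - dyadicAvg n m h x) 2 := hh.sub hE
  have e : hh.toLp h - (memLp_dyadicDiff hn m hm hh).toLp _ =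
      hs.toLp _ + hE'.toLp _ := by
    rw [← MemLp.toLp_sub, ← MemLp.toLp_add]
    congr 1
    ext x
    simp only [Pi.sub_apply, Pi.add_apply, dyadicDiff]
    ring
  rw [e, inner_add_right, inner_toLp_eq_zero_of_dyadicIndex _ _ (m := m)
    (fun x z => dyadicDiff_congr h) (setIntegral_sub_dyadicAvg hn m hm hh), zero_add,
    inner_eq_zero_symm]
  exact inner_toLp_eq_zero_of_dyadicIndex _ _ (m := m - 1)
    (fun x z => dyadicAvg_congr h) (setIntegral_dyadicDiff hn m hm hh)

section Orthogonal

variable {ι E : Type*} [NormedAddCommGroup E] [InnerProductSpace ℂ E]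

lemma norm_sum_sq_of_inner_eq_zero {v : ι → E} (hv : ∀ i j, i ≠ j → inner ℂ (v i) (v j) = 0)
    (S : Finset ι) : ‖∑ i ∈ S, v i‖ ^ 2 = ∑ i ∈ S, ‖v i‖ ^ 2 := by
  classical
  induction S using Finset.induction_on with
  | empty => simp
  | insert a S ha ih =>
    rw [Finset.sum_insert ha, Finset.sum_insert ha, ← ih, sq, sq, sq,
      norm_add_sq_eq_norm_sq_add_norm_sq_of_inner_eq_zero (𝕜 := ℂ)]
    rw [inner_sum]
    exact Finset.sum_eq_zero fun i hi => hv a i fun h => ha (h ▸ hi)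

/-- Bessel's inequality for the orthogonal projections `v i` of `f`. -/
lemma sum_norm_sq_le_of_inner_eq_zero {v : ι → E} {f : E}
    (hv : ∀ i j, i ≠ j → inner ℂ (v i) (v j) = 0) (hf : ∀ i, inner ℂ (v i) (f - v i) = 0)
    (S : Finset ι) : ∑ i ∈ S, ‖v i‖ ^ 2 ≤ ‖f‖ ^ 2 := by
  have h1 : inner ℂ (∑ i ∈ S, v i) (f - ∑ i ∈ S, v i) = 0 := by
    rw [sum_inner]
    refine Finset.sum_eq_zero fun i hi => ?_
    rw [inner_sub_right, inner_sum, Finset.sum_eq_single_of_mem i hi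
      (fun j _ hji => hv i j hji.symm), ← inner_sub_right, hf]
  have h2 := norm_add_sq_eq_norm_sq_add_norm_sq_of_inner_eq_zero (𝕜 := ℂ) _ _ h1
  rw [add_sub_cancel] at h2
  rw [← norm_sum_sq_of_inner_eq_zero hv, sq, sq, h2]
  exact le_add_of_nonneg_right (mul_self_nonneg _)

lemma exists_hasSum_of_inner_eq_zero [CompleteSpace E] {v : ι → E} {B : ℝ} (hB : 0 ≤ B)
    (hv : ∀ i j, i ≠ j → inner ℂ (v i) (v j) = 0)
    (hS : ∀ S : Finset ι, ∑ i ∈ S, ‖v i‖ ^ 2 ≤ B ^ 2) :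
    ∃ F, HasSum v F ∧ ‖F‖ ≤ B := by
  have hV : OrthogonalFamily ℂ (fun i => (ℂ ∙ v i : Submodule ℂ E))
      fun i => (ℂ ∙ v i).subtypeₗᵢ := by
    refine OrthogonalFamily.of_pairwise fun i j hij => ?_
    exact Submodule.isOrtho_span.2 (by simpa using hv i j hij)
  have hsum : Summable v := by
    have := (hV.summable_iff_norm_sq_summable
      fun i => ⟨v i, Submodule.mem_span_singleton_self _⟩).2
      (summable_of_sum_le (fun i => by positivity) hS)
    exact this
  refine ⟨_, hsum.hasSum, le_of_tendsto hsum.hasSum.norm (Filter.Eventually.of_forall fun S => ?_)⟩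
  refine abs_le_of_sq_le_sq' ?_ hB |>.2
  rw [norm_sum_sq_of_inner_eq_zero hv]
  exact hS S

end Orthogonal

lemma measurableSet_dyadicNear (n : ℕ) (j : ℤ) :
    MeasurableSet {p : (Fin n → ℝ) × (Fin n → ℝ) | DyadicNear n j p.1 p.2} := by
  have h : MeasurableSet {q : (Fin n → ℤ) × (Fin n → ℤ) | ∀ l, |q.1 l - q.2 l| ≤ 2} :=
    MeasurableSet.of_discrete
  exact ((measurable_dyadicIndex n j).prodMap (measurable_dyadicIndex n j)) h

lemma measurable_truncKernel {n : ℕ} (j : ℤ) {k : (Fin n → ℝ) → (Fin n → ℝ) → ℂ}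
    (hk : Measurable (Function.uncurry k)) :
    Measurable (Function.uncurry (truncKernel n j k)) :=
  Measurable.ite (measurableSet_dyadicNear n j) measurable_const hk

lemma measurable_truncKernel_comp {n : ℕ} {j : ℤ} {k : (Fin n → ℝ) → (Fin n → ℝ) → ℂ}
    (hk : Measurable (Function.uncurry k)) (x : Fin n → ℝ) {c : (Fin n → ℝ) → Fin n → ℝ}
    (hc : Measurable c) : Measurable fun y => truncKernel n j k x (c y) := by
  have hx : Measurable fun y => (x, c y) := measurable_const.prodMk hc
  simpa only [Function.comp_def, Function.uncurry_apply_pair] using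
    (measurable_truncKernel j hk).comp hx

/-- The operator with kernel `truncKernel n j k`. -/
def truncOp (n : ℕ) (j : ℤ) (k : (Fin n → ℝ) → (Fin n → ℝ) → ℂ) (g : (Fin n → ℝ) → ℂ)
    (x : Fin n → ℝ) : ℂ :=
  ∫ y, truncKernel n j k x y * g y

lemma setIntegral_dilatedCube_ae_eq_truncOp (n : ℕ) (j : ℤ)
    (k : (Fin n → ℝ) → (Fin n → ℝ) → ℂ) (g : (Fin n → ℝ) → ℂ) :
    (fun x => ∫ y in {y | x ∉ dilatedCube n 5 j y}, k x y * g y) =ᵐ[volume]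
      truncOp n j k g := by
  filter_upwards [ae_ne_dyadicIndex n j] with x hx
  have hS : {y | x ∉ dilatedCube n 5 j y} = {y | DyadicNear n j x y}ᶜ := by
    ext y
    exact (mem_dilatedCube_iff_dyadicNear hx).not
  have hm : MeasurableSet {y | DyadicNear n j x y} :=
    measurable_prodMk_left (measurableSet_dyadicNear n j)
  rw [hS, ← integral_indicator hm.compl, truncOp]
  congr 1
  ext y
  by_cases h : DyadicNear n j x y <;> simp [truncKernel, h]

section TruncOp

variable {n : ℕ} {j : ℤ} {k : (Fin n → ℝ) → (Fin n → ℝ) → ℂ} {g : (Fin n → ℝ) → ℂ}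

lemma measurable_truncOp (hk : Measurable (Function.uncurry k)) (hg : Measurable g) :
    Measurable (truncOp n j k g) :=
  (StronglyMeasurable.integral_prod_right (f := fun x y => truncKernel n j k x y * g y)
    (((measurable_truncKernel j hk).mul (hg.comp measurable_snd)).stronglyMeasurable)).measurable

lemma integrable_truncKernel_mul (hn : 1 ≤ n) (hk : Measurable (Function.uncurry k))
    (hsz : SizeKernel n k) (hg : MemLp g 2) (x : Fin n → ℝ) :
    Integrable fun y => truncKernel n j k x y * g y := by
  refine ((integrable_decayKernel_sub_mul_norm hn le_rfl (R := 2 ^ j) (by positivity) hg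
    x).const_mul (2 ^ n)).mono' ?_ (ae_of_all _ fun y => ?_)
  · exact ((measurable_truncKernel j hk).comp measurable_prodMk_left).aestronglyMeasurable.mul hg.1
  · rw [norm_mul, ← mul_assoc]
    exact mul_le_mul_of_nonneg_right (norm_truncKernel_le hsz x y) (norm_nonneg _)

/-- Decay of `truncOp` from the cancellation of `g` on cubes of generation `j + s - 1`. -/
lemma norm_truncOp_le (hn : 1 ≤ n) {γ : ℝ} (hγ0 : 0 < γ) (hγ1 : γ ≤ 1)
    (hk : Measurable (Function.uncurry k)) (hsz : SizeKernel n k) (hs : SmoothKernel n γ k)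
    (hg : MemLp g 2) {s : ℕ} (h0 : ∀ a, ∫ y in dyadicIndex n (j + s - 1) ⁻¹' {a}, g y = 0)
    (x : Fin n → ℝ) :
    ‖truncOp n j k g x‖ ≤ 4 * 9 ^ (n + 1) * 2 ^ (-γ * s) * decayAvg n γ (2 ^ j) g x := by
  have hM := integrable_decayKernel_sub_mul_norm hn hγ0.le (R := 2 ^ j) (by positivity) hg x
  obtain ⟨c, hcc, hci⟩ : ∃ c : (Fin n → ℝ) → Fin n → ℝ,
      (∀ y z, dyadicIndex n (j + s - 1) y = dyadicIndex n (j + s - 1) z → c y = c z) ∧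
      ∀ y, dyadicIndex n (j + s - 1) y = dyadicIndex n (j + s - 1) (c y) :=
    ⟨dyadicCorner n (j + s - 1), fun y z => dyadicCorner_congr,
      fun y => (dyadicIndex_dyadicCorner n _ y).symm⟩
  have hcm : Measurable c := measurable_of_dyadicIndex hcc
  have hb : ∀ y, ‖truncKernel n j k x y * g y - truncKernel n j k x (c y) * g y‖ ≤
      4 * 9 ^ (n + 1) * 2 ^ (-γ * s) * (decayKernel n γ (2 ^ j) (x - y) * ‖g y‖) := by
    intro y
    rw [← sub_mul, norm_mul, ← mul_assoc]
    exact mul_le_mul_of_nonneg_right (norm_truncKernel_sub_le hγ0 hγ1 hsz hs x (hci y))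
      (norm_nonneg _)
  generalize 4 * 9 ^ (n + 1) * (2:ℝ) ^ (-γ * s) = C at hb ⊢
  have hi := integrable_truncKernel_mul (j := j) hn hk hsz hg x
  have hkc := measurable_truncKernel_comp (j := j) hk x hcm
  have hd : Integrable fun y =>
      truncKernel n j k x y * g y - truncKernel n j k x (c y) * g y :=
    (hM.const_mul C).mono' (hi.1.sub (hkc.aestronglyMeasurable.mul hg.1)) (ae_of_all _ hb)
  have hi' : Integrable fun y => truncKernel n j k x (c y) * g y :=
    (hi.sub hd).congr (ae_of_all _ fun y => sub_sub_cancel _ _)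
  have hz : ∫ y, truncKernel n j k x (c y) * g y = 0 :=
    integral_mul_eq_zero_of_dyadicIndex (m := j + s - 1)
      (h := fun y => truncKernel n j k x (c y))
      (fun y z hyz => congrArg (truncKernel n j k x) (hcc y z hyz)) h0 hi'
  have e : truncOp n j k g x =
      ∫ y, (truncKernel n j k x y * g y - truncKernel n j k x (c y) * g y) := by
    rw [integral_sub hi hi', hz, sub_zero, truncOp]
  rw [e, decayAvg, ← integral_const_mul]
  exact norm_integral_le_of_norm_le (hM.const_mul C) (ae_of_all _ hb)

/-- Smoothness of `truncOp` on cubes of generation `j + i - 1`. -/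
lemma norm_truncOp_sub_le (hn : 1 ≤ n) {γ : ℝ} (hγ0 : 0 < γ) (hγ1 : γ ≤ 1)
    (hk : Measurable (Function.uncurry k)) (hsz : SizeKernel n k) (hs : SmoothKernel n γ k)
    (hg : MemLp g 2) {i : ℕ} {u x : Fin n → ℝ}
    (hux : dyadicIndex n (j + i - 1) u = dyadicIndex n (j + i - 1) x) :
    ‖truncOp n j k g u - truncOp n j k g x‖ ≤
      4 * 9 ^ (n + 1) * 2 ^ (-γ * i) * decayAvg n γ (2 ^ j) g x := by
  have hM := integrable_decayKernel_sub_mul_norm hn hγ0.le (R := 2 ^ j) (by positivity) hg x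
  rw [truncOp, truncOp, ← integral_sub (integrable_truncKernel_mul hn hk hsz hg u)
    (integrable_truncKernel_mul hn hk hsz hg x), decayAvg, ← integral_const_mul]
  refine norm_integral_le_of_norm_le (hM.const_mul _) (ae_of_all _ fun y => ?_)
  rw [← sub_mul, norm_mul, ← mul_assoc]
  refine mul_le_mul_of_nonneg_right ?_ (norm_nonneg _)
  have := norm_truncKernel_sub_le hγ0 hγ1 hsz.swap hs.swap y hux.symm
  rwa [truncKernel_swap n j k u y, truncKernel_swap n j k x y, norm_sub_rev, ← neg_sub x y, decayKernel_neg] at this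

lemma memLp_truncOp (hn : 1 ≤ n) {γ : ℝ} (hγ0 : 0 < γ) (hγ1 : γ ≤ 1)
    (hk : Measurable (Function.uncurry k)) (hsz : SizeKernel n k) (hs : SmoothKernel n γ k)
    (hgm : Measurable g) (hg : MemLp g 2) {s : ℕ}
    (h0 : ∀ a, ∫ y in dyadicIndex n (j + s - 1) ⁻¹' {a}, g y = 0) :
    MemLp (truncOp n j k g) 2 :=
  memLp_of_norm_le_decayAvg hγ0 (by positivity) hgm hg
    (measurable_truncOp hk hgm).aestronglyMeasurable
    (ae_of_all _ (norm_truncOp_le hn hγ0 hγ1 hk hsz hs hg h0))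

lemma norm_dyadicDiff_truncOp_le (hn : 1 ≤ n) {γ : ℝ} (hγ0 : 0 < γ) (hγ1 : γ ≤ 1)
    (hk : Measurable (Function.uncurry k)) (hsz : SizeKernel n k) (hs : SmoothKernel n γ k)
    (hgm : Measurable g) (hg : MemLp g 2) (i : ℕ) {s : ℕ}
    (h0 : ∀ a, ∫ y in dyadicIndex n (j + s - 1) ⁻¹' {a}, g y = 0) (x : Fin n → ℝ) :
    ‖dyadicDiff n (j + i) (truncOp n j k g) x‖ ≤
      8 * 27 ^ (n + 1) * 2 ^ (-γ * ((i:ℝ) + s) / 2) * decayAvg n γ (2 ^ j) g x := by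
  have hR : (0:ℝ) < 2 ^ j := by positivity
  have hM := decayAvg_nonneg n γ hR g x
  have hT := memLp_truncOp hn hγ0 hγ1 hk hsz hs hgm hg h0
  have h27 : (27:ℝ) ^ (n + 1) = 3 ^ (n + 1) * 9 ^ (n + 1) := by rw [← mul_pow]; norm_num
  have hle : j + (i:ℤ) - 1 ≤ j + i := by omega
  rcases le_total s i with hsi | his
  · have hB := fun u => norm_truncOp_sub_le (u := u) (x := x) (i := i) hn hγ0 hγ1 hk hsz hs hg
      (j := j)
    have h1 := norm_dyadicAvg_sub_le hT fun u hu => hB u (dyadicIndex_eq_of_le hle hu)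
    have h2 := norm_dyadicAvg_sub_le hT hB
    have hexp : (2:ℝ) ^ (-γ * i) ≤ 2 ^ (-γ * ((i:ℝ) + s) / 2) := by
      apply Real.rpow_le_rpow_of_exponent_le (by norm_num)
      have : (s:ℝ) ≤ i := by exact_mod_cast hsi
      nlinarith
    calc ‖dyadicDiff n (j + i) (truncOp n j k g) x‖ ≤ _ :=
          norm_sub_le_norm_sub_add_norm_sub _ (truncOp n j k g x) _
      _ ≤ 8 * (1 * 9 ^ (n + 1)) * 2 ^ (-γ * i) * decayAvg n γ (2 ^ j) g x := by
          rw [norm_sub_rev (truncOp n j k g x)]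
          linarith
      _ ≤ _ := by
          rw [h27]
          gcongr
          exact one_le_pow₀ (by norm_num)
  · have hB : ∀ u, dyadicIndex n (j + i - 1) u = dyadicIndex n (j + i - 1) x →
        ‖truncOp n j k g u - 0‖ ≤
          4 * 9 ^ (n + 1) * 2 ^ (-γ * s) * (3 ^ (n + 1) * decayAvg n γ (2 ^ j) g x) := by
      intro u hu
      rw [sub_zero]
      refine (norm_truncOp_le hn hγ0 hγ1 hk hsz hs hg h0 u).trans ?_
      refine mul_le_mul_of_nonneg_left ?_ (by positivity)
      refine decayAvg_le_of_norm_sub_le hn hγ0 hγ1 hR hg ?_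
      have h1 := norm_sub_le_of_dyadicIndex_eq
        (dyadicIndex_eq_of_le (show j - 1 ≤ j + i - 1 by omega) hu)
      rw [zpow_sub_one₀ two_ne_zero] at h1
      linarith
    have h1 := norm_dyadicAvg_sub_le hT fun u hu => hB u (dyadicIndex_eq_of_le hle hu)
    have h2 := norm_dyadicAvg_sub_le hT hB
    rw [sub_zero] at h1 h2
    have hexp : (2:ℝ) ^ (-γ * s) ≤ 2 ^ (-γ * ((i:ℝ) + s) / 2) := by
      apply Real.rpow_le_rpow_of_exponent_le (by norm_num)
      have : (i:ℝ) ≤ s := by exact_mod_cast his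
      nlinarith
    calc ‖dyadicDiff n (j + i) (truncOp n j k g) x‖ ≤ _ := norm_sub_le _ _
      _ ≤ 8 * (3 ^ (n + 1) * 9 ^ (n + 1)) * 2 ^ (-γ * s) * decayAvg n γ (2 ^ j) g x := by linarith
      _ ≤ _ := by
          rw [h27]
          gcongr

lemma eLpNorm_dyadicDiff_truncOp_le (hn : 1 ≤ n) {γ : ℝ} (hγ0 : 0 < γ) (hγ1 : γ ≤ 1)
    (hk : Measurable (Function.uncurry k)) (hsz : SizeKernel n k) (hs : SmoothKernel n γ k)
    (hgm : Measurable g) (hg : MemLp g 2) (i : ℕ) {s : ℕ}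
    (h0 : ∀ a, ∫ y in dyadicIndex n (j + s - 1) ⁻¹' {a}, g y = 0) :
    eLpNorm (dyadicDiff n (j + i) (truncOp n j k g)) 2 volume ≤
      ENNReal.ofReal (8 * 27 ^ (n + 1) * decayMass n γ * 2 ^ (-γ * ((i:ℝ) + s) / 2)) *
        eLpNorm g 2 volume := by
  have hR : (0:ℝ) < 2 ^ j := by positivity
  have h1 := eLpNorm_le_mul_eLpNorm_of_ae_le_mul (p := 2) (μ := volume)
    (f := dyadicDiff n (j + i) (truncOp n j k g)) (g := decayAvg n γ (2 ^ j) g)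
    (c := 8 * 27 ^ (n + 1) * 2 ^ (-γ * ((i:ℝ) + s) / 2)) (ae_of_all _ fun x => by
      rw [Real.norm_of_nonneg (decayAvg_nonneg n γ hR g x)]
      exact norm_dyadicDiff_truncOp_le hn hγ0 hγ1 hk hsz hs hgm hg i h0 x)
  refine (h1.trans (mul_le_mul_right (eLpNorm_decayAvg_le n hγ0 hR hgm) _)).trans_eq ?_
  rw [← mul_assoc, ← ENNReal.ofReal_mul (by positivity)]
  congr 2
  ring

end TruncOp

/-- `L²` estimate for the block operator `Φ_i`: the series
`Σ_{j ∈ ℤ} Δ_{j+i}(T_j(Δ_{j+s} f))`, with `T_j` the truncated singular integral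
`T_j g(x) = ∫_{x ∉ 5Q_{y,j}} k(x,y) g(y) dy`, converges in `L²(ℝ^n)` and its sum has
norm at most `c · 2^{-γ(i+s)/2} ‖f‖₂`, with `c` depending only on `n` and `γ`. -/
theorem block_operator_phi_estimate (n : ℕ) (hn : 1 ≤ n) (γ : ℝ)
    (hγ0 : 0 < γ) (hγ1 : γ ≤ 1) :
    ∃ c : ℝ, 0 < c ∧
      ∀ k : (Fin n → ℝ) → (Fin n → ℝ) → ℂ,
        Measurable (Function.uncurry k) → SizeKernel n k → SmoothKernel n γ k →
        ∀ (i s : ℕ) (f : Lp ℂ 2 (volume : Measure (Fin n → ℝ))),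
          ∃ (G : ℤ → Lp ℂ 2 (volume : Measure (Fin n → ℝ)))
            (F : Lp ℂ 2 (volume : Measure (Fin n → ℝ))),
            (∀ j : ℤ, (G j : (Fin n → ℝ) → ℂ) =ᵐ[volume]
              dyadicDiff n (j + i)
                (fun x => ∫ y in {y | x ∉ dilatedCube n 5 j y},
                  k x y * dyadicDiff n (j + s) (f : (Fin n → ℝ) → ℂ) y)) ∧
            HasSum G F ∧
            ‖F‖ ≤ c * 2 ^ (-γ * ((i:ℝ) + s) / 2) * ‖f‖ := by
  have hA := decayMass_nonneg n γ
  refine ⟨8 * 27 ^ (n + 1) * decayMass n γ + 1, by positivity, ?_⟩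
  intro k hk hsz hs i s f
  have hfm : Measurable (f : (Fin n → ℝ) → ℂ) := (Lp.stronglyMeasurable f).measurable
  have hf : MemLp (f : (Fin n → ℝ) → ℂ) 2 := Lp.memLp f
  set g : ℤ → (Fin n → ℝ) → ℂ := fun j => dyadicDiff n (j + s) f with hgdef
  have hgm : ∀ j, Measurable (g j) := fun j => measurable_dyadicDiff n _ _
  have hg : ∀ j, MemLp (g j) 2 := fun j => memLp_dyadicDiff hn _ hfm hf
  have h0 : ∀ j a, ∫ y in dyadicIndex n (j + s - 1) ⁻¹' {a}, g j y = 0 :=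
    fun j => setIntegral_dyadicDiff hn _ hfm hf
  have hTm : ∀ j, Measurable (truncOp n j k (g j)) := fun j => measurable_truncOp hk (hgm j)
  have hT : ∀ j, MemLp (truncOp n j k (g j)) 2 := fun j =>
    memLp_truncOp hn hγ0 hγ1 hk hsz hs (hgm j) (hg j) (h0 j)
  have hG : ∀ j : ℤ, MemLp (dyadicDiff n (j + i) (truncOp n j k (g j))) 2 := fun j =>
    memLp_dyadicDiff hn _ (hTm j) (hT j)
  set K : ℝ := (8 * 27 ^ (n + 1) * decayMass n γ + 1) * 2 ^ (-γ * ((i:ℝ) + s) / 2) with hK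
  have hK0 : 0 ≤ K := by positivity
  have hnorm : ∀ j, ‖(hG j).toLp _‖ ≤ K * ‖(hg j).toLp _‖ := by
    intro j
    rw [Lp.norm_toLp, Lp.norm_toLp]
    have := ENNReal.toReal_mono (ENNReal.mul_ne_top ENNReal.ofReal_ne_top (hg j).2.ne)
      (eLpNorm_dyadicDiff_truncOp_le hn hγ0 hγ1 hk hsz hs (hgm j) (hg j) i (h0 j))
    rw [ENNReal.toReal_mul, ENNReal.toReal_ofReal (by positivity)] at this
    refine this.trans (mul_le_mul_of_nonneg_right ?_ ENNReal.toReal_nonneg)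
    rw [hK]
    gcongr
    linarith
  have hbessel : ∀ S : Finset ℤ, ∑ j ∈ S, ‖(hg j).toLp _‖ ^ 2 ≤ ‖f‖ ^ 2 := by
    intro S
    have hff : hf.toLp _ = f := Lp.toLp_coeFn f hf
    refine sum_norm_sq_le_of_inner_eq_zero
      (fun j l hjl => inner_dyadicDiff_eq_zero hn (by simpa using hjl) hfm hf hfm hf)
      (fun j => ?_) S
    have := inner_dyadicDiff_sub_eq_zero hn (j + s) hfm hf
    rwa [hff] at this
  obtain ⟨F, hF, hFn⟩ := exists_hasSum_of_inner_eq_zero (v := fun j => (hG j).toLp _)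
    (B := K * ‖f‖) (by positivity)
    (fun j l hjl => inner_dyadicDiff_eq_zero hn (by simpa using hjl) (hTm j) (hT j) (hTm l) (hT l))
    (fun S => by
      calc ∑ j ∈ S, ‖(hG j).toLp _‖ ^ 2 ≤ ∑ j ∈ S, K ^ 2 * ‖(hg j).toLp _‖ ^ 2 :=
            Finset.sum_le_sum fun j _ => by
              rw [← mul_pow]
              exact pow_le_pow_left₀ (norm_nonneg _) (hnorm j) 2
        _ ≤ (K * ‖f‖) ^ 2 := by
            rw [← Finset.mul_sum, mul_pow K ‖f‖]
            exact mul_le_mul_of_nonneg_left (hbessel S) (sq_nonneg K))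
  refine ⟨fun j => (hG j).toLp _, F, fun j => ?_, hF, hFn⟩
  refine (hG j).coeFn_toLp.trans (Filter.EventuallyEq.of_eq ?_)
  exact (dyadicDiff_congr_ae (setIntegral_dilatedCube_ae_eq_truncOp n j k (g j))).symm
end
end
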